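/- arXiv:0908.4221 — 7 statements merged into one kernel-verified Lean document; each statement's English description precedes it below -/
import Mathlib

section
/- Suppose G is a finite measure or h is bounded. Assume there exist γ > d and C > 0 such that h(x)·Ḡ←(C‖x‖^{−γ}) → 0 as ‖x‖ → ∞, where Ḡ←(t) = inf{u > 0 : Ḡ(u) ≤ t}. Then α⁻(h,G) = α⁺(h,G) = 0. -/
open MeasureTheory ENNReal Filter

noncomputable section

variable {E : Type*} [NormedAddCommGroup E] [MeasureSpace E]

/-- The integrand `x ↦ Ḡ(u / h x)` with the conventions `Ḡ(u/h(x)) = 0` when `h x = 0`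
and `Ḡ(u/h(x)) = G((0,∞))` when `h x = ∞`. -/
def tailIntegrand (G : Measure ℝ) (h : E → ℝ≥0∞) (u : ℝ) (x : E) : ℝ≥0∞ :=
  if h x = 0 then 0
  else if h x = ⊤ then G (Set.Ioi (0 : ℝ))
  else G (Set.Ioi (u / (h x).toReal))

/-- `α(h,G) = inf{u > 0 : ∫ Ḡ(u/h(x)) dx < ∞}`, with `inf ∅ = ∞` (computed in `ℝ≥0∞`). -/
def alphaCoef (G : Measure ℝ) (h : E → ℝ≥0∞) : ℝ≥0∞ :=
  sInf (ENNReal.ofReal '' {u : ℝ | 0 < u ∧ (∫⁻ x, tailIntegrand G h u x) < ⊤})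

/-- `h⁺_ε(x) = sup_{‖z‖ ≤ ε} h (x + z)` -/
def supBall (h : E → ℝ≥0∞) (ε : ℝ) (x : E) : ℝ≥0∞ :=
  ⨆ z ∈ Metric.closedBall (0 : E) ε, h (x + z)

/-- `h⁻_ε(x) = inf_{‖z‖ ≤ ε} h (x + z)` -/
def infBall (h : E → ℝ≥0∞) (ε : ℝ) (x : E) : ℝ≥0∞ :=
  ⨅ z ∈ Metric.closedBall (0 : E) ε, h (x + z)

/-- `α⁺(h,G) = α(h⁺,G)` with `h⁺ = h⁺_1`. -/
def alphaPlus (G : Measure ℝ) (h : E → ℝ≥0∞) : ℝ≥0∞ := alphaCoef G (supBall h 1)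

/-- `α⁻(h,G) = sup_{ε > 0} α(h⁻_ε, G) = lim_{ε → 0} α(h⁻_ε, G)`. -/
def alphaMinus (G : Measure ℝ) (h : E → ℝ≥0∞) : ℝ≥0∞ :=
  ⨆ ε ∈ Set.Ioi (0 : ℝ), alphaCoef G (infBall h ε)

/-- `Ḡ←(t) = inf{u > 0 : Ḡ(u) ≤ t}`. -/
def tailInv (G : Measure ℝ) (t : ℝ≥0∞) : ℝ := sInf {u : ℝ | 0 < u ∧ G (Set.Ioi u) ≤ t}

omit [NormedAddCommGroup E] [MeasureSpace E] in
theorem tailIntegrand_mono (G : Measure ℝ) {h k : E → ℝ≥0∞} {u : ℝ} (hu : 0 < u) {x : E}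
    (hk : h x ≤ k x) : tailIntegrand G h u x ≤ tailIntegrand G k u x := by
  unfold tailIntegrand
  by_cases h0 : h x = 0
  · simp [h0]
  have k0 : k x ≠ 0 := fun hk0 => h0 (le_antisymm (hk0 ▸ hk) bot_le)
  by_cases kt : k x = ⊤
  · simp only [h0, kt, if_false, if_true, ENNReal.top_ne_zero]
    split_ifs
    · exact le_rfl
    · exact measure_mono (Set.Ioi_subset_Ioi (by positivity))
  have ht : h x ≠ ⊤ := ne_top_of_le_ne_top kt hk
  simp only [h0, k0, ht, kt, if_false]
  refine measure_mono (Set.Ioi_subset_Ioi ?_)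
  exact div_le_div_of_nonneg_left hu.le (ENNReal.toReal_pos h0 ht) (ENNReal.toReal_mono kt hk)

omit [NormedAddCommGroup E] [MeasureSpace E] in
theorem tailIntegrand_le_measure_Ioi_zero (G : Measure ℝ) (h : E → ℝ≥0∞) {u : ℝ} (hu : 0 < u)
    (x : E) : tailIntegrand G h u x ≤ G (Set.Ioi 0) := by
  refine (tailIntegrand_mono G (k := fun _ => ⊤) hu le_top).trans ?_
  simp [tailIntegrand]

omit [NormedAddCommGroup E] in
theorem alphaCoef_mono (G : Measure ℝ) {h k : E → ℝ≥0∞} (hk : h ≤ k) :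
    alphaCoef G h ≤ alphaCoef G k := by
  refine sInf_le_sInf (Set.image_mono fun u hu => ⟨hu.1, ?_⟩)
  exact (lintegral_mono fun x => tailIntegrand_mono G hu.1 (hk x)).trans_lt hu.2

omit [NormedAddCommGroup E] in
theorem alphaCoef_eq_zero_of_forall (G : Measure ℝ) {h : E → ℝ≥0∞}
    (hfin : ∀ u : ℝ, 0 < u → (∫⁻ x, tailIntegrand G h u x) < ⊤) : alphaCoef G h = 0 := by
  refine le_antisymm (ENNReal.le_of_forall_pos_le_add fun ε hε _ => ?_) bot_le
  have hε' : (0 : ℝ) < ε := hε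
  rw [zero_add, ← ENNReal.ofReal_coe_nnreal]
  exact sInf_le ⟨ε, ⟨hε', hfin ε hε'⟩, rfl⟩

omit [MeasureSpace E] in
theorem le_supBall (h : E → ℝ≥0∞) {ε : ℝ} (hε : 0 ≤ ε) : h ≤ supBall h ε := fun x =>
  le_iSup₂_of_le (f := fun z (_ : z ∈ Metric.closedBall (0 : E) ε) => h (x + z)) 0
    (by simpa using hε) (by simp)

omit [MeasureSpace E] in
theorem infBall_le (h : E → ℝ≥0∞) {ε : ℝ} (hε : 0 ≤ ε) : infBall h ε ≤ h := fun x =>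
  iInf₂_le_of_le (f := fun z (_ : z ∈ Metric.closedBall (0 : E) ε) => h (x + z)) 0
    (by simpa using hε) (by simp)

theorem alphaMinus_le_alphaPlus (G : Measure ℝ) (h : E → ℝ≥0∞) :
    alphaMinus G h ≤ alphaPlus G h :=
  iSup₂_le fun _ hε => alphaCoef_mono G
    ((infBall_le h (le_of_lt hε)).trans (le_supBall h zero_le_one))

section Tail

variable {G : Measure ℝ}

theorem tailInv_set_nonempty (htail : ∀ u : ℝ, 0 < u → G (Set.Ioi u) < ⊤)
    {t : ℝ≥0∞} (ht : 0 < t) : {u : ℝ | 0 < u ∧ G (Set.Ioi u) ≤ t}.Nonempty := by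
  have hlim : Tendsto (fun n : ℝ => G (Set.Ioi n)) atTop (nhds (G (⋂ n : ℝ, Set.Ioi n))) :=
    tendsto_measure_iInter_atTop (fun _ => measurableSet_Ioi.nullMeasurableSet)
      (fun _ _ hab => Set.Ioi_subset_Ioi hab) ⟨1, (htail 1 one_pos).ne⟩
  have hempty : (⋂ n : ℝ, Set.Ioi n) = (∅ : Set ℝ) := by
    ext x
    simpa using ⟨x, le_rfl⟩
  rw [hempty, measure_empty] at hlim
  obtain ⟨u, hu, hu'⟩ := ((hlim.eventually (eventually_le_nhds ht)).and
    (eventually_gt_atTop 0)).exists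
  exact ⟨u, hu', hu⟩

theorem tailInv_nonneg (G : Measure ℝ) (t : ℝ≥0∞) : 0 ≤ tailInv G t :=
  Real.sInf_nonneg fun _ hu => hu.1.le

theorem tailInv_anti (htail : ∀ u : ℝ, 0 < u → G (Set.Ioi u) < ⊤) {s t : ℝ≥0∞}
    (hs : 0 < s) (hst : s ≤ t) : tailInv G t ≤ tailInv G s :=
  csInf_le_csInf ⟨0, fun _ hu => hu.1.le⟩ (tailInv_set_nonempty htail hs)
    fun _ hu => ⟨hu.1, hu.2.trans hst⟩

theorem measure_Ioi_le_of_tailInv_lt (htail : ∀ u : ℝ, 0 < u → G (Set.Ioi u) < ⊤)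
    {t : ℝ≥0∞} (ht : 0 < t) {v : ℝ} (hv : tailInv G t < v) : G (Set.Ioi v) ≤ t := by
  obtain ⟨w, hw, hwv⟩ := exists_lt_of_csInf_lt (tailInv_set_nonempty htail ht) hv
  exact (measure_mono (Set.Ioi_subset_Ioi hwv.le)).trans hw.2

theorem measure_Ioi_tailInv_le (htail : ∀ u : ℝ, 0 < u → G (Set.Ioi u) < ⊤)
    {t : ℝ≥0∞} (ht : 0 < t) : G (Set.Ioi (tailInv G t)) ≤ t := by
  obtain ⟨v, hanti, hgt, hv⟩ := exists_seq_strictAnti_tendsto (tailInv G t)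
  have hUnion : Set.Ioi (tailInv G t) = ⋃ n, Set.Ioi (v n) := by
    ext x
    simp only [Set.mem_Ioi, Set.mem_iUnion]
    exact ⟨fun hx => (hv.eventually (eventually_lt_nhds hx)).exists,
      fun ⟨n, hn⟩ => (hgt n).trans hn⟩
  have hmono : Monotone fun n => Set.Ioi (v n) :=
    fun _ _ hab => Set.Ioi_subset_Ioi (hanti.antitone hab)
  rw [hUnion, hmono.measure_iUnion]
  exact iSup_le fun n => measure_Ioi_le_of_tailInv_lt htail ht (hgt n)

omit [NormedAddCommGroup E] [MeasureSpace E] in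
theorem tailIntegrand_le_of_mul_tailInv_le (htail : ∀ u : ℝ, 0 < u → G (Set.Ioi u) < ⊤)
    {h : E → ℝ≥0∞} {u : ℝ} (hu : 0 < u) {x : E} {t : ℝ≥0∞} (ht : 0 < t)
    (hx : h x * ENNReal.ofReal (tailInv G t) ≤ ENNReal.ofReal u) :
    tailIntegrand G h u x ≤ t := by
  rcases (tailInv_nonneg G t).eq_or_lt with hT | hT
  · refine (tailIntegrand_le_measure_Ioi_zero G h hu x).trans ?_
    rw [hT]
    exact measure_Ioi_tailInv_le htail ht
  unfold tailIntegrand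
  split_ifs with h0 htop
  · exact bot_le
  · rw [htop, ENNReal.top_mul (by simpa using hT)] at hx
    exact absurd hx (by simp)
  · refine (measure_mono (Set.Ioi_subset_Ioi ?_)).trans (measure_Ioi_tailInv_le htail ht)
    rw [le_div_iff₀ (ENNReal.toReal_pos h0 htop)]
    have := ENNReal.toReal_mono ENNReal.ofReal_ne_top hx
    rw [ENNReal.toReal_mul, ENNReal.toReal_ofReal hT.le, ENNReal.toReal_ofReal hu.le] at this
    linarith

end Tail

omit [MeasureSpace E] in
theorem exists_tailIntegrand_le {G : Measure ℝ} (htail : ∀ u : ℝ, 0 < u → G (Set.Ioi u) < ⊤)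
    {h : E → ℝ≥0∞} (hfin : IsFiniteMeasure G ∨ ∃ B : ℝ≥0∞, B ≠ ⊤ ∧ ∀ x, h x ≤ B)
    {u : ℝ} (hu : 0 < u) : ∃ K : ℝ≥0∞, K < ⊤ ∧ ∀ x, tailIntegrand G h u x ≤ K := by
  rcases hfin with hG | ⟨B, hB, hle⟩
  · exact ⟨G (Set.Ioi 0), measure_lt_top _ _, tailIntegrand_le_measure_Ioi_zero G h hu⟩
  refine ⟨tailIntegrand G (fun _ : E => B) u 0, ?_, fun x =>
    (tailIntegrand_mono G (k := fun _ => B) (x := x) hu (hle x)).trans_eq rfl⟩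
  simp only [tailIntegrand, hB, if_false]
  split_ifs with hB0
  · simp
  · exact htail _ (div_pos hu (ENNReal.toReal_pos hB0 hB))

omit [MeasureSpace E] in
theorem supBall_tail_bound {G : Measure ℝ} (htail : ∀ u : ℝ, 0 < u → G (Set.Ioi u) < ⊤)
    {h : E → ℝ≥0∞} {γ C : ℝ} (hγ : 0 ≤ γ) (hC : 0 < C) {R : ℝ} {η : ℝ≥0∞}
    (hR : ∀ y : E, R ≤ ‖y‖ →
      h y * ENNReal.ofReal (tailInv G (ENNReal.ofReal (C * ‖y‖ ^ (-γ)))) ≤ η)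
    {x : E} (hx : R + 1 ≤ ‖x‖) (hx2 : 2 ≤ ‖x‖) :
    supBall h 1 x *
      ENNReal.ofReal (tailInv G (ENNReal.ofReal (C * ((1 + ‖x‖) / 4) ^ (-γ)))) ≤ η := by
  simp only [supBall, ENNReal.iSup_mul]
  refine iSup₂_le fun z hz => ?_
  have hz1 : ‖z‖ ≤ 1 := by simpa using hz
  have hxz : ‖x‖ - ‖z‖ ≤ ‖x + z‖ := by simpa using norm_sub_norm_le x (-z)
  refine le_trans ?_ (hR (x + z) (by linarith))
  have hpos : 0 < ‖x + z‖ := by linarith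
  gcongr
  refine tailInv_anti htail (ENNReal.ofReal_pos.2 (by positivity)) (ENNReal.ofReal_le_ofReal ?_)
  exact mul_le_mul_of_nonneg_left (Real.rpow_le_rpow_of_nonpos (by positivity) (by linarith)
    (by linarith)) hC.le

/-- Proposition 2.8 (1): if `G` is finite or `h` is bounded and
`h(x)·Ḡ←(C‖x‖^{-γ}) → 0` as `‖x‖ → ∞` for some `γ > d`, `C > 0`, then
`α⁻(h,G) = α⁺(h,G) = 0`. -/
theorem alphaMinus_eq_alphaPlus_eq_zero
    {d : ℕ} (hd : 1 ≤ d) (G : Measure ℝ) (h : EuclideanSpace ℝ (Fin d) → ℝ≥0∞)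
    (hmeas : Measurable h)
    (htail : ∀ u : ℝ, 0 < u → G (Set.Ioi u) < ⊤)
    (hfin : IsFiniteMeasure G ∨ ∃ B : ℝ≥0∞, B ≠ ⊤ ∧ ∀ x, h x ≤ B)
    (γ C : ℝ) (hγ : (d : ℝ) < γ) (hC : 0 < C)
    (hlim : Tendsto
      (fun x : EuclideanSpace ℝ (Fin d) =>
        h x * ENNReal.ofReal (tailInv G (ENNReal.ofReal (C * ‖x‖ ^ (-γ)))))
      (comap (fun x : EuclideanSpace ℝ (Fin d) => ‖x‖) atTop) (nhds 0)) :
    alphaMinus G h = 0 ∧ alphaPlus G h = 0 := by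
  suffices hplus : alphaPlus G h = 0 from
    ⟨le_antisymm (hplus ▸ alphaMinus_le_alphaPlus G h) bot_le, hplus⟩
  refine alphaCoef_eq_zero_of_forall G fun u hu => ?_
  have hev := hlim.eventually (eventually_le_nhds (ENNReal.ofReal_pos.2 hu))
  obtain ⟨R, hR⟩ := eventually_atTop.1 (eventually_comap.1 hev)
  have hfin' : IsFiniteMeasure G ∨ ∃ B : ℝ≥0∞, B ≠ ⊤ ∧ ∀ x, supBall h 1 x ≤ B :=
    hfin.imp_right fun ⟨B, hB, hle⟩ => ⟨B, hB, fun x => iSup₂_le fun z _ => hle (x + z)⟩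
  obtain ⟨K, hK, hKle⟩ := exists_tailIntegrand_le htail hfin' hu
  have hγ0 : 0 ≤ γ := (Nat.cast_nonneg d).trans hγ.le
  set A := Metric.ball (0 : EuclideanSpace ℝ (Fin d)) (max (R + 1) 2)
  rw [← lintegral_add_compl _ (measurableSet_ball : MeasurableSet A)]
  refine ENNReal.add_lt_top.2 ⟨?_, ?_⟩
  · refine (lintegral_mono fun x => hKle x).trans_lt ?_
    rw [setLIntegral_const]
    exact ENNReal.mul_lt_top hK measure_ball_lt_top
  have hbound : ∀ x ∈ Aᶜ, tailIntegrand G (supBall h 1) u x ≤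
      ENNReal.ofReal (C * 4 ^ γ) * ENNReal.ofReal ((1 + ‖x‖) ^ (-γ)) := by
    intro x hx
    have hx' : max (R + 1) 2 ≤ ‖x‖ := by simpa [A] using hx
    have hpos : 0 < 1 + ‖x‖ := by positivity
    have heq : C * ((1 + ‖x‖) / 4) ^ (-γ) = C * 4 ^ γ * (1 + ‖x‖) ^ (-γ) := by
      rw [Real.div_rpow hpos.le (by norm_num), Real.rpow_neg (by norm_num : (0 : ℝ) ≤ 4),
        div_inv_eq_mul]
      ring
    rw [← ENNReal.ofReal_mul (by positivity), ← heq]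
    exact tailIntegrand_le_of_mul_tailInv_le htail hu (ENNReal.ofReal_pos.2 (by positivity))
      (supBall_tail_bound htail hγ0 hC (fun y hy => hR _ hy y rfl)
        ((le_max_left _ _).trans hx') ((le_max_right _ _).trans hx'))
  refine (setLIntegral_mono' measurableSet_ball.compl hbound).trans_lt ?_
  refine (setLIntegral_le_lintegral _ _).trans_lt ?_
  rw [lintegral_const_mul' _ _ ENNReal.ofReal_ne_top]
  exact ENNReal.mul_lt_top ENNReal.ofReal_lt_top (finite_integral_one_add_norm (by simpa using hγ))
end
end

section
/- Let ξ > 0, let G be a probability measure on (0,+∞) with Ḡ ∈ RV_{−ξ}, and suppose h satisfies condition (C_ξ). Then α⁺(h, λG) = 0 for every λ > 0, and also α⁺(h, G_ξ) = 0, where G_ξ is the measure on (0,+∞) with tail Ḡ_ξ(u) = u^{−ξ}. -/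
open MeasureTheory ENNReal Filter

noncomputable section

variable {E : Type*} [NormedAddCommGroup E] [MeasureSpace E]

/-- `Ḡ ∈ RV_{-ξ}`: the tail function of `G` is everywhere positive and
`Ḡ(tu)/Ḡ(u) → t^{-ξ}` as `u → ∞` for every `t > 0`. -/
def RegVaryTail (G : Measure ℝ) (ξ : ℝ) : Prop :=
  (∀ u : ℝ, 0 < u → 0 < G (Set.Ioi u)) ∧
  ∀ t : ℝ, 0 < t →
    Tendsto (fun u : ℝ => G (Set.Ioi (t * u)) / G (Set.Ioi u)) atTop
      (nhds (ENNReal.ofReal (t ^ (-ξ))))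

/-- `a_λ = inf{x > 0 : Ḡ(x) ≤ λ⁻¹}`. -/
def aScale (G : Measure ℝ) (lam : ℝ) : ℝ :=
  sInf {x : ℝ | 0 < x ∧ G (Set.Ioi x) ≤ ENNReal.ofReal lam⁻¹}

/-- Condition (C_ξ): `∫ h⁺(x)^{ξ-δ} dx < ∞` for some `δ ∈ (0,ξ)`. -/
def CondC {E : Type*} [NormedAddCommGroup E] [MeasureSpace E]
    (h : E → ℝ≥0∞) (ξ : ℝ) : Prop :=
  ∃ δ : ℝ, 0 < δ ∧ δ < ξ ∧ (∫⁻ x, (supBall h 1 x) ^ (ξ - δ)) < ⊤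

theorem le_supBall_s2 {E : Type*} [NormedAddCommGroup E] (h : E → ℝ≥0∞) {ε : ℝ} {x y : E}
    (hy : x ∈ Metric.closedBall y ε) : h y ≤ supBall h ε x := by
  have hz : y - x ∈ Metric.closedBall (0 : E) ε := by
    rw [Metric.mem_closedBall, dist_eq_norm] at hy
    rw [mem_closedBall_zero_iff, norm_sub_rev]
    exact hy
  have key := le_iSup₂ (f := fun z (_ : z ∈ Metric.closedBall (0 : E) ε) => h (x + z)) (y - x) hz
  simpa [supBall] using key

/-- If some positive power of `h⁺` has finite integral, then `h⁺` is bounded. -/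
theorem exists_supBall_le {E : Type*} [NormedAddCommGroup E] [MeasureSpace E] [BorelSpace E]
    [ProperSpace E] [(volume : Measure E).IsAddHaarMeasure] {h : E → ℝ≥0∞} {p : ℝ} (hp : 0 < p)
    (hint : (∫⁻ x, (supBall h 1 x) ^ p) < ⊤) :
    ∃ M : ℝ≥0∞, M ≠ ⊤ ∧ ∀ x, supBall h 1 x ≤ M := by
  set v : ℝ≥0∞ := volume (Metric.closedBall (0 : E) 1)
  have hv0 : v ≠ 0 := (Metric.measure_closedBall_pos volume (0 : E) one_pos).ne'
  have hvtop : v ≠ ⊤ := measure_closedBall_lt_top.ne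
  refine ⟨((∫⁻ x, (supBall h 1 x) ^ p) / v) ^ p⁻¹,
    ENNReal.rpow_ne_top_of_nonneg (inv_nonneg.2 hp.le) (ENNReal.div_lt_top hint.ne hv0).ne,
    fun x => iSup₂_le fun z _ => ?_⟩
  rw [ENNReal.le_rpow_inv_iff hp, ENNReal.le_div_iff_mul_le (Or.inl hv0) (Or.inl hvtop)]
  calc h (x + z) ^ p * v = ∫⁻ _ in Metric.closedBall (x + z) 1, h (x + z) ^ p := by
        rw [setLIntegral_const, Measure.addHaar_closedBall_center]
    _ ≤ ∫⁻ w in Metric.closedBall (x + z) 1, (supBall h 1 w) ^ p :=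
        setLIntegral_mono' Metric.isClosed_closedBall.measurableSet fun w hw =>
          ENNReal.rpow_le_rpow (le_supBall_s2 h hw) hp.le
    _ ≤ ∫⁻ w, (supBall h 1 w) ^ p := setLIntegral_le_lintegral _ _

theorem alphaCoef_eq_zero {E : Type*} [NormedAddCommGroup E] [MeasureSpace E]
    {G : Measure ℝ} {k : E → ℝ≥0∞}
    (hG : ∀ u : ℝ, 0 < u → (∫⁻ x, tailIntegrand G k u x) < ⊤) : alphaCoef G k = 0 := by
  refine le_antisymm (le_of_forall_gt fun c hc => ?_) zero_le
  obtain ⟨u, hu0, huc⟩ := ENNReal.lt_iff_exists_nnreal_btwn.1 hc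
  refine lt_of_le_of_lt (sInf_le ⟨u, ⟨?_, hG u ?_⟩, ENNReal.ofReal_coe_nnreal⟩) huc <;>
  exact_mod_cast hu0

/-- A bounded function `k` with `∫ k ^ p < ∞` has `α(k,G) = 0` as soon as the tail of `G` is
`O(s ^ (-p))` away from the origin. -/
theorem alphaCoef_eq_zero_of_tail_le {E : Type*} [NormedAddCommGroup E] [MeasureSpace E]
    {G : Measure ℝ} {k : E → ℝ≥0∞} {p : ℝ}
    {M : ℝ≥0∞} (hM : M ≠ ⊤) (hkM : ∀ x, k x ≤ M) (hint : (∫⁻ x, (k x) ^ p) < ⊤)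
    (hG : ∀ s₀ : ℝ, 0 < s₀ → ∃ C : ℝ≥0∞, C ≠ ⊤ ∧
      ∀ s : ℝ, s₀ ≤ s → G (Set.Ioi s) ≤ C * ENNReal.ofReal (s ^ (-p))) :
    alphaCoef G k = 0 := by
  refine alphaCoef_eq_zero fun u hu => ?_
  obtain ⟨C, hC, hCG⟩ := hG (u / (M.toReal + 1)) (by positivity)
  have hD : C * ENNReal.ofReal (u ^ (-p)) ≠ ⊤ := ENNReal.mul_ne_top hC ENNReal.ofReal_ne_top
  suffices hle : ∀ x, tailIntegrand G k u x ≤ C * ENNReal.ofReal (u ^ (-p)) * (k x) ^ p by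
    refine (lintegral_mono hle).trans_lt ?_
    rw [lintegral_const_mul' _ _ hD]
    exact ENNReal.mul_lt_top hD.lt_top hint
  intro x
  have hktop : k x ≠ ⊤ := ne_top_of_le_ne_top hM (hkM x)
  by_cases hk0 : k x = 0
  · simp [tailIntegrand, hk0]
  have hr : 0 < (k x).toReal := ENNReal.toReal_pos hk0 hktop
  have hrM : (k x).toReal ≤ M.toReal + 1 := (ENNReal.toReal_mono hM (hkM x)).trans (by linarith)
  simp only [tailIntegrand, hk0, hktop, if_false]
  refine (hCG _ (div_le_div_of_nonneg_left hu.le hr hrM)).trans_eq ?_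
  rw [Real.div_rpow hu.le hr.le, Real.rpow_neg hr.le, div_inv_eq_mul,
    ENNReal.ofReal_mul (by positivity), ← ENNReal.ofReal_rpow_of_pos hr,
    ENNReal.ofReal_toReal hktop, mul_assoc]

/-- A Potter-type bound: a regularly varying tail of index `-ξ` is dominated by `s ^ (-p)`
for `p < ξ`. -/
theorem RegVaryTail.exists_tail_le {G : Measure ℝ} [IsProbabilityMeasure G] {ξ p : ℝ}
    (hRV : RegVaryTail G ξ) (hp : 0 < p) (hpξ : p < ξ) :
    ∃ D : ℝ, 0 < D ∧ ∀ s : ℝ, 0 < s → G (Set.Ioi s) ≤ ENNReal.ofReal ((s / D) ^ (-p)) := by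
  have hlt : ENNReal.ofReal ((2 : ℝ) ^ (-ξ)) < ENNReal.ofReal ((2 : ℝ) ^ (-p)) :=
    (ENNReal.ofReal_lt_ofReal_iff (by positivity)).2
      (Real.rpow_lt_rpow_of_exponent_lt one_lt_two (by linarith))
  obtain ⟨U₀, hU₀⟩ := eventually_atTop.1 ((hRV.2 2 two_pos).eventually_lt_const hlt)
  set U : ℝ := max U₀ 1
  have hU : 0 < U := lt_of_lt_of_le one_pos (le_max_right _ _)
  have hdouble : ∀ s, U ≤ s →
      G (Set.Ioi (2 * s)) ≤ ENNReal.ofReal ((2 : ℝ) ^ (-p)) * G (Set.Ioi s) := fun s hs =>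
    (ENNReal.div_le_iff (hRV.1 s (hU.trans_le hs)).ne' (measure_ne_top _ _)).1
      (hU₀ s ((le_max_left _ _).trans hs)).le
  have hsmall : ∀ s, 0 < s → s ≤ 2 * U →
      G (Set.Ioi s) ≤ ENNReal.ofReal ((s / (2 * U)) ^ (-p)) := fun s hs hsU => by
    refine prob_le_one.trans (ENNReal.one_le_ofReal.2 ?_)
    exact Real.one_le_rpow_of_pos_of_le_one_of_nonpos (by positivity)
      ((div_le_one (by positivity)).2 hsU) (by linarith)
  have hind : ∀ (n : ℕ) (s : ℝ), 0 < s → s ≤ 2 ^ n * (2 * U) →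
      G (Set.Ioi s) ≤ ENNReal.ofReal ((s / (2 * U)) ^ (-p)) := by
    intro n
    induction n with
    | zero => exact fun s hs hsU => hsmall s hs (by simpa using hsU)
    | succ n ih =>
      intro s hs hsU
      rcases le_total s (2 * U) with hle | hge
      · exact hsmall s hs hle
      have hhalf := ih (s / 2) (by positivity) (by rw [pow_succ] at hsU; linarith)
      have hd := hdouble (s / 2) (by linarith)
      rw [mul_div_cancel₀ s two_ne_zero] at hd
      refine (hd.trans (mul_le_mul_right hhalf _)).trans_eq ?_
      rw [← ENNReal.ofReal_mul (by positivity), ← Real.mul_rpow (by positivity) (by positivity)]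
      congr 2
      field_simp
  refine ⟨2 * U, by positivity, fun s hs => ?_⟩
  obtain ⟨n, hn⟩ := pow_unbounded_of_one_lt (s / (2 * U)) one_lt_two
  exact hind n s hs ((div_le_iff₀ (by positivity)).1 hn.le)

/-- Lemma 3.1 (1): if `Ḡ ∈ RV_{-ξ}` and `h` satisfies condition (C_ξ), then
`α⁺(h, λG) = 0` for every `λ > 0`, and also `α⁺(h, G_ξ) = 0` where `G_ξ` has tail
`Ḡ_ξ(u) = u^{-ξ}`. -/
theorem alphaPlus_eq_zero_of_condC
    {d : ℕ} (hd : 1 ≤ d) (ξ : ℝ) (hξ : 0 < ξ)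
    (G : Measure ℝ) [IsProbabilityMeasure G] (hG0 : G (Set.Iic (0 : ℝ)) = 0)
    (hRV : RegVaryTail G ξ)
    (h : EuclideanSpace ℝ (Fin d) → ℝ≥0∞) (hmeas : Measurable h)
    (hCξ : CondC h ξ) :
    (∀ lam : ℝ, 0 < lam → alphaPlus (ENNReal.ofReal lam • G) h = 0) ∧
    (∀ Gξ : Measure ℝ,
      (∀ u : ℝ, 0 < u → Gξ (Set.Ioi u) = ENNReal.ofReal (u ^ (-ξ))) →
      alphaPlus Gξ h = 0) := by
  obtain ⟨δ, hδ, hδξ, hint⟩ := hCξ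
  have hp : 0 < ξ - δ := sub_pos.2 hδξ
  obtain ⟨M, hM, hkM⟩ := exists_supBall_le hp hint
  refine ⟨fun lam _ => ?_, fun Gξ hGξ => ?_⟩
  · obtain ⟨D, hD, hDG⟩ := hRV.exists_tail_le hp (by linarith)
    refine alphaCoef_eq_zero_of_tail_le hM hkM hint fun s₀ hs₀ =>
      ⟨ENNReal.ofReal lam * ENNReal.ofReal (D ^ (ξ - δ)),
        ENNReal.mul_ne_top ENNReal.ofReal_ne_top ENNReal.ofReal_ne_top, fun s hs => ?_⟩
    have hs0 : 0 < s := hs₀.trans_le hs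
    rw [Measure.smul_apply, smul_eq_mul, mul_assoc, ← ENNReal.ofReal_mul (by positivity)]
    refine mul_le_mul_right ((hDG s hs0).trans_eq ?_) _
    rw [Real.div_rpow hs0.le hD.le, Real.rpow_neg hD.le, div_inv_eq_mul, mul_comm]
  · refine alphaCoef_eq_zero_of_tail_le hM hkM hint fun s₀ hs₀ =>
      ⟨ENNReal.ofReal (s₀ ^ (-δ)), ENNReal.ofReal_ne_top, fun s hs => ?_⟩
    have hs0 : 0 < s := hs₀.trans_le hs
    rw [hGξ s hs0, ← ENNReal.ofReal_mul (by positivity)]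
    refine ENNReal.ofReal_le_ofReal ?_
    rw [show -ξ = -δ + -(ξ - δ) by ring, Real.rpow_add hs0]
    exact mul_le_mul_of_nonneg_right
      (Real.rpow_le_rpow_of_nonpos hs₀ hs (by linarith)) (by positivity)
end
end

section
/- If A₁ and A₂ are bounded subsets of ℝ^d with nonempty interior, then α(h_{A₁},G) = α(h_{A₂},G). -/
open MeasureTheory ENNReal Filter

noncomputable section

variable {E : Type*} [NormedAddCommGroup E] [MeasureSpace E]

/-- `h_A(x) = sup_{z ∈ A} h (x + z)`. -/
def supOver (h : E → ℝ≥0∞) (A : Set E) (x : E) : ℝ≥0∞ := ⨆ z ∈ A, h (x + z)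

/-- The function `t ↦ Ḡ(u/t)` on `[0,∞]` underlying `tailIntegrand`. -/
def tailFun (G : Measure ℝ) (u : ℝ) (t : ℝ≥0∞) : ℝ≥0∞ :=
  if t = 0 then 0
  else if t = ⊤ then G (Set.Ioi (0 : ℝ))
  else G (Set.Ioi (u / t.toReal))

theorem tailFun_monotone (G : Measure ℝ) {u : ℝ} (hu : 0 < u) : Monotone (tailFun G u) := by
  intro s t hst
  unfold tailFun
  by_cases hs : s = 0
  · simp [hs]
  have ht : t ≠ 0 := fun h0 => hs (le_bot_iff.mp (hst.trans h0.le))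
  rw [if_neg hs, if_neg ht]
  by_cases ht' : t = ⊤
  · rw [if_pos ht']
    split_ifs
    · exact le_rfl
    · exact measure_mono (Set.Ioi_subset_Ioi (by positivity))
  · have hs' : s ≠ ⊤ := ne_top_of_le_ne_top ht' hst
    rw [if_neg hs', if_neg ht']
    have hpos : 0 < s.toReal := ENNReal.toReal_pos hs hs'
    have hle : s.toReal ≤ t.toReal := ENNReal.toReal_mono ht' hst
    exact measure_mono (Set.Ioi_subset_Ioi (by gcongr))

theorem supOver_mono_set {F : Type*} [NormedAddCommGroup F] (h : F → ℝ≥0∞) {A B : Set F}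
    (hAB : A ⊆ B) (x : F) : supOver h A x ≤ supOver h B x :=
  biSup_mono hAB

theorem lowerSemicontinuous_supOver {F : Type*} [NormedAddCommGroup F] (h : F → ℝ≥0∞)
    {B : Set F} (hB : IsOpen B) : LowerSemicontinuous (supOver h B) := by
  rw [lowerSemicontinuous_iff_isOpen_preimage]
  intro a
  have heq : supOver h B ⁻¹' Set.Ioi a = ⋃ w ∈ {w | a < h w}, (fun x => w - x) ⁻¹' B := by
    ext x
    simp only [supOver, Set.mem_preimage, Set.mem_Ioi, lt_iSup_iff, Set.mem_iUnion,
      Set.mem_ofPred_eq]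
    constructor
    · rintro ⟨z, hz, hlt⟩
      exact ⟨x + z, hlt, by simpa using hz⟩
    · rintro ⟨w, hlt, hw⟩
      exact ⟨w - x, hw, by simpa using hlt⟩
  rw [heq]
  exact isOpen_biUnion fun w _ => hB.preimage (by fun_prop)

theorem exists_finset_supOver_le {F : Type*} [NormedAddCommGroup F] (h : F → ℝ≥0∞)
    {A : Set F} (hA : TotallyBounded A) (c : F) {r : ℝ} (hr : 0 < r) :
    ∃ t : Finset F, ∀ x, supOver h A x ≤
      t.sup fun y => supOver h (Metric.ball c r) (x + (y - c)) := by
  obtain ⟨t, ht, hcover⟩ := Metric.totallyBounded_iff.mp hA r hr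
  refine ⟨ht.toFinset, fun x => iSup₂_le fun z hz => ?_⟩
  obtain ⟨y, hy, hzy⟩ := Set.mem_iUnion₂.mp (hcover hz)
  refine le_trans ?_ (Finset.le_sup (ht.mem_toFinset.mpr hy))
  have hmem : z - y + c ∈ Metric.ball c r := by
    simpa [mem_ball_iff_norm, dist_eq_norm] using hzy
  refine le_trans (le_of_eq ?_) (le_iSup₂ (z - y + c) hmem)
  congr 1
  abel

theorem lintegral_tailIntegrand_supOver_lt_top {F : Type*} [NormedAddCommGroup F]
    [MeasureSpace F] [BorelSpace F] [(volume : Measure F).IsAddRightInvariant]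
    (G : Measure ℝ) (h : F → ℝ≥0∞) {A B : Set F} (hA : TotallyBounded A)
    (hB : (interior B).Nonempty) {u : ℝ} (hu : 0 < u)
    (hfin : (∫⁻ x, tailIntegrand G (supOver h B) u x) < ⊤) :
    (∫⁻ x, tailIntegrand G (supOver h A) u x) < ⊤ := by
  obtain ⟨c, hc⟩ := hB
  obtain ⟨r, hr, hball⟩ := Metric.isOpen_iff.mp isOpen_interior c hc
  obtain ⟨t, ht⟩ := exists_finset_supOver_le h hA c hr
  have hmono := tailFun_monotone G hu
  set g : F → ℝ≥0∞ := fun x => tailFun G u (supOver h (Metric.ball c r) x)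
  have hg : Measurable g := hmono.measurable.comp
    (lowerSemicontinuous_supOver h Metric.isOpen_ball).measurable
  have hg_fin : ∫⁻ x, g x < ⊤ := lt_of_le_of_lt
    (lintegral_mono fun x => hmono (supOver_mono_set h (hball.trans interior_subset) x)) hfin
  have hpoint : ∀ x, tailFun G u (supOver h A x) ≤ ∑ y ∈ t, g (x + (y - c)) := by
    intro x
    refine (hmono (ht x)).trans ?_
    rw [Finset.apply_sup_eq_sup_comp_of_linearOrder _ hmono (by simp [tailFun])]
    exact Finset.sup_le fun y hy =>
      Finset.single_le_sum (f := fun y => g (x + (y - c))) (fun _ _ => zero_le) hy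
  calc ∫⁻ x, tailFun G u (supOver h A x)
      ≤ ∫⁻ x, ∑ y ∈ t, g (x + (y - c)) := lintegral_mono hpoint
    _ = ∑ y ∈ t, ∫⁻ x, g (x + (y - c)) :=
      lintegral_finsetSum _ fun y _ => hg.comp (continuous_add_const _).measurable
    _ = ∑ _y ∈ t, ∫⁻ x, g x :=
      Finset.sum_congr rfl fun y _ => lintegral_add_right_eq_self g (y - c)
    _ < ⊤ := ENNReal.sum_lt_top.mpr fun _ _ => hg_fin

/-- Remark 2.6: for any bounded sets `A₁, A₂` with nonempty interior,
`α(h_{A₁},G) = α(h_{A₂},G)`. -/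
theorem alpha_supOver_bounded_nonempty_interior
    {d : ℕ} (hd : 1 ≤ d) (G : Measure ℝ)
    (htail : ∀ u : ℝ, 0 < u → G (Set.Ioi u) < ⊤)
    (h : EuclideanSpace ℝ (Fin d) → ℝ≥0∞) (hmeas : Measurable h)
    (A₁ A₂ : Set (EuclideanSpace ℝ (Fin d)))
    (hb₁ : Bornology.IsBounded A₁) (hb₂ : Bornology.IsBounded A₂)
    (hi₁ : (interior A₁).Nonempty) (hi₂ : (interior A₂).Nonempty) :
    alphaCoef G (supOver h A₁) = alphaCoef G (supOver h A₂) := by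
  have htb : ∀ {A : Set (EuclideanSpace ℝ (Fin d))}, Bornology.IsBounded A → TotallyBounded A :=
    fun hA => hA.isCompact_closure.totallyBounded.subset subset_closure
  unfold alphaCoef
  congr 2
  ext u
  exact and_congr_right fun hu =>
    ⟨lintegral_tailIntegrand_supOver_lt_top G h (htb hb₂) hi₁ hu,
      lintegral_tailIntegrand_supOver_lt_top G h (htb hb₁) hi₂ hu⟩
end
end

section
/- Let d ≥ 1, ξ > 0, let G be a probability measure on (0,+∞) with Ḡ ∈ RV_{−ξ}, and let h : ℝ^d → [0,+∞) be measurable, not identically 0, and satisfy condition (C'_ξ). Set ‖h‖_∞ = sup_{x∈ℝ^d} h(x), h_R(x) = sup_{‖z‖≤R} h(x+z) for R > 0, a_t = inf{x > 0 : Ḡ(x) ≤ t^{−1}} for t > 1, and let c_d be the Lebesgue volume of the Euclidean unit ball in ℝ^d. Then for every u > 0, ∫_{ℝ^d} Ḡ(a_{R^d}·‖h‖_∞·u / h_R(x)) dx → c_d·u^{−ξ} as R → +∞ (with the convention Ḡ(v/h_R(x)) = 0 when h_R(x) = 0). -/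
open MeasureTheory ENNReal Filter

noncomputable section

/-- `h_R(x) = sup_{‖z‖ ≤ R} h(x+z)` for a real-valued shape function. -/
def supBallR {E : Type*} [NormedAddCommGroup E] (h : E → ℝ) (R : ℝ) (x : E) : ℝ :=
  sSup ((fun z => h (x + z)) '' Metric.closedBall (0 : E) R)

open scoped Topology

/-- A squeeze theorem for families of bounds whose limits become arbitrarily sharp. -/
lemma tendsto_of_family_bounds {α β ι : Type*} [LinearOrder α] [TopologicalSpace α]
    [OrderTopology α] {F : Filter β} [F.NeBot] {l : Filter ι} {f : ι → α}
    {lo up : β → ι → α} {p q : β → α} {L : α}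
    (hlo : ∀ᶠ b in F, ∀ᶠ i in l, lo b i ≤ f i)
    (hlo' : ∀ᶠ b in F, Tendsto (lo b) l (𝓝 (p b))) (hp : Tendsto p F (𝓝 L))
    (hup : ∀ᶠ b in F, ∀ᶠ i in l, f i ≤ up b i)
    (hup' : ∀ᶠ b in F, Tendsto (up b) l (𝓝 (q b))) (hq : Tendsto q F (𝓝 L)) :
    Tendsto f l (𝓝 L) := by
  refine tendsto_order.2 ⟨fun c hc => ?_, fun c hc => ?_⟩
  · obtain ⟨b, h1, h2, h3⟩ := (hlo.and (hlo'.and (hp.eventually_const_lt hc))).exists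
    filter_upwards [h1, h2.eventually_const_lt h3] with i hi hi' using hi'.trans_le hi
  · obtain ⟨b, h1, h2, h3⟩ := (hup.and (hup'.and (hq.eventually_lt_const hc))).exists
    filter_upwards [h1, h2.eventually_lt_const h3] with i hi hi' using hi.trans_lt hi'

/-- The tail of `G` is the coercion of the real-valued tail. -/
lemma ofReal_real_Ioi (G : Measure ℝ) [IsProbabilityMeasure G] (x : ℝ) :
    ENNReal.ofReal (G.real (Set.Ioi x)) = G (Set.Ioi x) :=
  ofReal_measureReal

lemma antitone_real_Ioi (G : Measure ℝ) [IsProbabilityMeasure G] :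
    Antitone fun x : ℝ => G.real (Set.Ioi x) :=
  fun _ _ hxy => measureReal_mono (Set.Ioi_subset_Ioi hxy)

lemma tendsto_real_Ioi_atTop (G : Measure ℝ) [IsProbabilityMeasure G] :
    Tendsto (fun x : ℝ => G.real (Set.Ioi x)) atTop (𝓝 0) := by
  have h1 := tendsto_measure_iInter_atTop (μ := G) (s := fun x : ℝ => Set.Ioi x)
    (fun _ => measurableSet_Ioi.nullMeasurableSet) (fun _ _ h => Set.Ioi_subset_Ioi h)
    ⟨0, measure_ne_top _ _⟩
  have h2 : (⋂ x : ℝ, Set.Ioi x) = ∅ := by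
    ext y
    simp only [Set.mem_iInter, Set.mem_Ioi, Set.mem_empty_iff_false, iff_false, not_forall]
    exact ⟨y, lt_irrefl y⟩
  rw [h2, measure_empty] at h1
  exact (ENNReal.tendsto_toReal ENNReal.zero_ne_top).comp h1

namespace RegVaryTail

variable {G : Measure ℝ} [IsProbabilityMeasure G] {ξ : ℝ}

lemma real_pos (hRV : RegVaryTail G ξ) {x : ℝ} (hx : 0 < x) : 0 < G.real (Set.Ioi x) :=
  ENNReal.toReal_pos (hRV.1 x hx).ne' (measure_ne_top _ _)

lemma tendsto_real_div {G : Measure ℝ} {ξ : ℝ} (hRV : RegVaryTail G ξ) {t s : ℝ} (ht : 0 < t) (hs : 0 < s) :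
    Tendsto (fun x : ℝ => G.real (Set.Ioi (t * x)) / G.real (Set.Ioi (s * x))) atTop
      (𝓝 ((t / s) ^ (-ξ))) := by
  have h1 := (ENNReal.tendsto_toReal ENNReal.ofReal_ne_top).comp (hRV.2 (t / s) (by positivity))
  rw [ENNReal.toReal_ofReal (by positivity)] at h1
  refine (h1.comp (tendsto_id.const_mul_atTop hs)).congr fun x => ?_
  have : t / s * (s * x) = t * x := by field_simp
  simp [Measure.real, this]

/-- A Potter-type bound. -/
lemma exists_potter_bound (hRV : RegVaryTail G ξ) {η : ℝ} (hη : 0 < η) (hηξ : η < ξ) :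
    ∀ᶠ x in atTop, ∀ s : ℝ, 1 ≤ s →
      G.real (Set.Ioi (s * x)) ≤ 2 ^ η * s ^ (-η) * G.real (Set.Ioi x) := by
  have h1 := hRV.tendsto_real_div (t := 2) (s := 1) (by norm_num) (by norm_num)
  have h2 : ((2 : ℝ) / 1) ^ (-ξ) < 2 ^ (-η) := by
    rw [div_one]
    exact Real.rpow_lt_rpow_of_exponent_lt (by norm_num) (by linarith)
  obtain ⟨x₀, hx₀⟩ := eventually_atTop.1 (h1.eventually_lt_const h2)
  filter_upwards [eventually_ge_atTop x₀, eventually_gt_atTop 0] with x hx hx' s hs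
  have step (n : ℕ) : G.real (Set.Ioi (2 ^ n * x)) ≤
      ((2 : ℝ) ^ (-η)) ^ n * G.real (Set.Ioi x) := by
    induction n with
    | zero => simp
    | succ n ih =>
      have hn : x ≤ 2 ^ n * x := le_mul_of_one_le_left hx'.le (one_le_pow₀ (by norm_num))
      have h3 := (hx₀ (2 ^ n * x) (hx.trans hn)).le
      rw [one_mul, div_le_iff₀ (hRV.real_pos (by positivity))] at h3
      calc G.real (Set.Ioi (2 ^ (n + 1) * x))
          = G.real (Set.Ioi (2 * (2 ^ n * x))) := by ring_nf
        _ ≤ 2 ^ (-η) * G.real (Set.Ioi (2 ^ n * x)) := h3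
        _ ≤ 2 ^ (-η) * (((2 : ℝ) ^ (-η)) ^ n * G.real (Set.Ioi x)) := by gcongr
        _ = ((2 : ℝ) ^ (-η)) ^ (n + 1) * G.real (Set.Ioi x) := by ring
  obtain ⟨n, hn, hn'⟩ := exists_nat_pow_near hs (one_lt_two (α := ℝ))
  refine (antitone_real_Ioi G (mul_le_mul_of_nonneg_right hn hx'.le)).trans
    ((step n).trans (mul_le_mul_of_nonneg_right ?_ measureReal_nonneg))
  have h4 : ((2 : ℝ) ^ (n + 1)) ^ (-η) ≤ s ^ (-η) :=
    Real.rpow_le_rpow_of_nonpos (by linarith) hn'.le (by linarith)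
  calc ((2 : ℝ) ^ (-η)) ^ n = 2 ^ η * ((2 : ℝ) ^ (n + 1)) ^ (-η) := by
        rw [← Real.rpow_natCast, ← Real.rpow_natCast, ← Real.rpow_mul (by norm_num),
          ← Real.rpow_mul (by norm_num), ← Real.rpow_add (by norm_num)]
        push_cast
        ring_nf
    _ ≤ 2 ^ η * s ^ (-η) := by gcongr

end RegVaryTail

section Scale

variable {G : Measure ℝ} [IsProbabilityMeasure G] {ξ : ℝ}

lemma exists_mem_scale_set (G : Measure ℝ) [IsProbabilityMeasure G] {lam : ℝ} (hlam : 0 < lam) :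
    ∃ x : ℝ, 0 < x ∧ G (Set.Ioi x) ≤ ENNReal.ofReal lam⁻¹ := by
  obtain ⟨x, hx, hx'⟩ := ((eventually_gt_atTop 0).and ((tendsto_real_Ioi_atTop G).eventually_le_const
    (inv_pos.2 hlam))).exists
  exact ⟨x, hx, by rw [← ofReal_real_Ioi]; exact ENNReal.ofReal_le_ofReal hx'⟩

lemma real_Ioi_le_of_aScale_lt {lam x : ℝ} (hlam : 0 < lam) (hx : aScale G lam < x) :
    G.real (Set.Ioi x) ≤ lam⁻¹ := by
  obtain ⟨y, ⟨-, hy⟩, hyx⟩ := exists_lt_of_csInf_lt (exists_mem_scale_set G hlam) hx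
  refine (antitone_real_Ioi G hyx.le).trans ?_
  rwa [← ofReal_real_Ioi, ENNReal.ofReal_le_ofReal_iff (by positivity)] at hy

lemma le_real_Ioi_of_lt_aScale {lam x : ℝ} (hx : 0 < x) (hx' : x < aScale G lam) :
    lam⁻¹ ≤ G.real (Set.Ioi x) := by
  by_contra! hlt
  refine notMem_of_lt_csInf hx' ⟨0, fun y hy => hy.1.le⟩ ⟨hx, ?_⟩
  rw [← ofReal_real_Ioi]
  exact ENNReal.ofReal_le_ofReal hlt.le

lemma RegVaryTail.tendsto_aScale (hRV : RegVaryTail G ξ) :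
    Tendsto (aScale G) atTop atTop := by
  refine tendsto_atTop.2 fun B => ?_
  have hB' : 0 < max B 1 := by positivity
  filter_upwards [tendsto_inv_atTop_zero.eventually_lt_const (hRV.real_pos hB'),
    eventually_gt_atTop 0] with lam hlam hlam'
  refine (le_max_left B 1).trans (le_csInf (exists_mem_scale_set G hlam') fun y hy => ?_)
  by_contra! hlt
  have h1 := hy.2
  rw [← ofReal_real_Ioi, ENNReal.ofReal_le_ofReal_iff (by positivity)] at h1
  exact (((antitone_real_Ioi G hlt.le).trans h1).trans_lt hlam).false

/-- `λ Ḡ(a_λ u) → u^{-ξ}` as `λ → ∞`. -/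
lemma RegVaryTail.tendsto_mul_real_aScale (hRV : RegVaryTail G ξ) {u : ℝ} (hu : 0 < u) :
    Tendsto (fun lam : ℝ => lam * G.real (Set.Ioi (u * aScale G lam))) atTop
      (𝓝 (u ^ (-ξ))) := by
  have hcont (s : ℝ) : Tendsto (fun ε : ℝ => (u / (1 + s * ε)) ^ (-ξ)) (𝓝[>] 0)
      (𝓝 (u ^ (-ξ))) := by
    have : ContinuousAt (fun ε : ℝ => (u / (1 + s * ε)) ^ (-ξ)) 0 := by
      refine ContinuousAt.rpow_const (ContinuousAt.div (by fun_prop) (by fun_prop) (by simp))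
        (Or.inl (by simp [hu.ne']))
    simpa using this.tendsto.mono_left nhdsWithin_le_nhds
  have hsmall : ∀ᶠ ε : ℝ in 𝓝[>] 0, 0 < ε ∧ ε < 1 := Ioo_mem_nhdsGT one_pos
  have hlim {s : ℝ} (hs : 0 < s) := (hRV.tendsto_real_div hu hs).comp hRV.tendsto_aScale
  refine tendsto_of_family_bounds (F := 𝓝[>] (0 : ℝ))
    (hsmall.mono fun ε hε => ?_)
    (hsmall.mono fun ε hε => hlim (s := 1 + (-1) * ε) (by linarith)) (hcont (-1))
    (hsmall.mono fun ε hε => ?_)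
    (hsmall.mono fun ε hε => hlim (s := 1 + 1 * ε) (by linarith)) (hcont 1)
  · filter_upwards [eventually_gt_atTop 0, hRV.tendsto_aScale.eventually_gt_atTop 0]
      with lam hlam ha
    have hpos : 0 < (1 + (-1) * ε) * aScale G lam := mul_pos (by linarith) ha
    have h1 := le_real_Ioi_of_lt_aScale (G := G) (lam := lam) hpos (by nlinarith)
    rw [Function.comp_apply, div_eq_inv_mul]
    exact mul_le_mul_of_nonneg_right (inv_le_of_inv_le₀ hlam h1) measureReal_nonneg
  · filter_upwards [eventually_gt_atTop 0, hRV.tendsto_aScale.eventually_gt_atTop 0]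
      with lam hlam ha
    have hpos : 0 < (1 + 1 * ε) * aScale G lam := mul_pos (by linarith) ha
    have h1 := real_Ioi_le_of_aScale_lt (G := G) (lam := lam) (x := (1 + 1 * ε) * aScale G lam)
      hlam (by nlinarith)
    rw [Function.comp_apply, div_eq_inv_mul]
    exact mul_le_mul_of_nonneg_right (le_inv_of_le_inv₀ (hRV.real_pos hpos) h1)
      measureReal_nonneg

end Scale

section SupBall

variable {E : Type*} [NormedAddCommGroup E] {h : E → ℝ}

lemma le_supBallR (hbdd : BddAbove (Set.range h)) {R : ℝ} {x y : E} (hxy : ‖y - x‖ ≤ R) :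
    h y ≤ supBallR h R x := by
  refine le_csSup (hbdd.mono ?_) ⟨y - x, by simpa using hxy, by simp⟩
  rintro _ ⟨z, -, rfl⟩
  exact ⟨x + z, rfl⟩

lemma supBallR_nonneg (hpos : ∀ x, 0 ≤ h x) (R : ℝ) (x : E) : 0 ≤ supBallR h R x := by
  refine Real.sSup_nonneg ?_
  rintro _ ⟨z, -, rfl⟩
  exact hpos _

lemma supBallR_le {R : ℝ} (hR : 0 ≤ R) {x : E} {D : ℝ}
    (hD : ∀ z, ‖z‖ ≤ R → h (x + z) ≤ D) : supBallR h R x ≤ D := by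
  refine csSup_le (Set.Nonempty.image _ ⟨0, by simpa using hR⟩) ?_
  rintro _ ⟨z, hz, rfl⟩
  exact hD z (by simpa using hz)

/-- Polynomial decay of `h` passes to `supBallR h R` outside the ball of radius `R`. -/
lemma supBallR_le_rpow {R γ C : ℝ} (hR : 0 ≤ R) (hγ : 0 ≤ γ) (hC : 0 ≤ C)
    (hdecay : ∀ x, x ≠ 0 → h x ≤ C * ‖x‖ ^ (-γ)) {x : E} {r : ℝ} (hr : 0 < r)
    (hrx : r ≤ ‖x‖ - R) : supBallR h R x ≤ C * r ^ (-γ) := by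
  refine supBallR_le hR fun z hz => ?_
  have h1 : r ≤ ‖x + z‖ := by
    have := norm_sub_le (x + z) z
    rw [add_sub_cancel_right] at this
    linarith
  refine (hdecay _ (norm_pos_iff.1 (hr.trans_le h1))).trans ?_
  exact mul_le_mul_of_nonneg_left (Real.rpow_le_rpow_of_nonpos hr h1 (by linarith)) hC

end SupBall

section Integrand

variable {G : Measure ℝ} {b D H : ℝ}

lemma ite_tail_le (hb : 0 ≤ b) (hH : 0 ≤ H) (hHD : H ≤ D) :
    (if H = 0 then 0 else G (Set.Ioi (b / H))) ≤ G (Set.Ioi (b / D)) := by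
  split_ifs with h0
  · exact zero_le
  · have : 0 < H := lt_of_le_of_ne hH (Ne.symm h0)
    exact measure_mono (Set.Ioi_subset_Ioi (by gcongr))

lemma le_ite_tail (hb : 0 ≤ b) (hD : 0 < D) (hDH : D ≤ H) :
    G (Set.Ioi (b / D)) ≤ if H = 0 then 0 else G (Set.Ioi (b / H)) := by
  rw [if_neg (hD.trans_le hDH).ne']
  exact measure_mono (Set.Ioi_subset_Ioi (by gcongr))

end Integrand

/-- `Ḡ(a_{R^d} v) · vol(B(0, s R + c)) → s^d v^{-ξ} c_d` as `R → ∞`. -/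
lemma RegVaryTail.tendsto_tail_mul_volume_ball {d : ℕ} (hd : 1 ≤ d) {G : Measure ℝ}
    [IsProbabilityMeasure G] {ξ : ℝ} (hRV : RegVaryTail G ξ) {v : ℝ} (hv : 0 < v) {s : ℝ}
    (hs : 0 < s) (c : ℝ) :
    Tendsto (fun R : ℝ => G (Set.Ioi (v * aScale G (R ^ d))) *
        volume (Metric.ball (0 : EuclideanSpace ℝ (Fin d)) (s * R + c))) atTop
      (𝓝 (volume (Metric.ball (0 : EuclideanSpace ℝ (Fin d)) 1) *
        ENNReal.ofReal (s ^ d * v ^ (-ξ)))) := by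
  have : Nontrivial (EuclideanSpace ℝ (Fin d)) := by
    have : Nonempty (Fin d) := ⟨⟨0, hd⟩⟩
    infer_instance
  have h1 := (hRV.tendsto_mul_real_aScale hv).comp
    (tendsto_pow_atTop (α := ℝ) (Nat.one_le_iff_ne_zero.1 hd))
  have h2 : Tendsto (fun R : ℝ => (s + c * R⁻¹) ^ d) atTop (𝓝 (s ^ d)) := by
    simpa using ((tendsto_inv_atTop_zero.const_mul c).const_add s).pow d
  have h3 := ENNReal.Tendsto.const_mul
    (a := volume (Metric.ball (0 : EuclideanSpace ℝ (Fin d)) 1))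
    (ENNReal.tendsto_ofReal (h2.mul h1)) (Or.inr measure_ball_lt_top.ne)
  refine h3.congr' ?_
  have h4 : ∀ᶠ R : ℝ in atTop, 0 ≤ s * R + c :=
    (tendsto_atTop_add_const_right _ c (tendsto_id.const_mul_atTop hs)).eventually_ge_atTop 0
  filter_upwards [eventually_gt_atTop 0, h4] with R hR hR'
  rw [Measure.addHaar_ball _ _ hR', finrank_euclideanSpace_fin, ← ofReal_real_Ioi, ← mul_assoc,
    ← ENNReal.ofReal_mul measureReal_nonneg, mul_comm (volume _)]
  congr 2
  have h5 : s * R + c = (s + c * R⁻¹) * R := by field_simp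
  rw [h5, mul_pow, Function.comp_apply]
  ring

section Bounds

variable {d : ℕ} {ξ : ℝ} {G : Measure ℝ} [IsProbabilityMeasure G]
  {h : EuclideanSpace ℝ (Fin d) → ℝ} {u : ℝ}

lemma eventually_le_lintegral_tail (hd : 1 ≤ d) (hRV : RegVaryTail G ξ)
    (hbdd : BddAbove (Set.range h)) (hM : 0 < sSup (Set.range h)) (hu : 0 < u)
    {ε : ℝ} (hε : 0 < ε) (hε1 : ε < 1) :
    ∃ c : ℝ, ∀ᶠ R : ℝ in atTop,
      G (Set.Ioi (u / (1 - ε) * aScale G (R ^ d))) *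
          volume (Metric.ball (0 : EuclideanSpace ℝ (Fin d)) (1 * R + c)) ≤
        ∫⁻ x, if supBallR h R x = 0 then 0
          else G (Set.Ioi (aScale G (R ^ d) * sSup (Set.range h) * u / supBallR h R x)) := by
  set M := sSup (Set.range h)
  obtain ⟨_, ⟨z, rfl⟩, hz⟩ := exists_lt_of_lt_csSup (Set.range_nonempty h)
    (show (1 - ε) * M < M by nlinarith)
  have hD : 0 < (1 - ε) * M := mul_pos (by linarith) hM
  refine ⟨-‖z‖, ?_⟩
  filter_upwards [(hRV.tendsto_aScale.comp
    (tendsto_pow_atTop (Nat.one_le_iff_ne_zero.1 hd))).eventually_gt_atTop 0] with R ha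
  rw [Function.comp_apply] at ha
  rw [← setLIntegral_const]
  refine (setLIntegral_mono' measurableSet_ball fun x hx => ?_).trans (setLIntegral_le_lintegral _ _)
  rw [mem_ball_zero_iff] at hx
  have h1 : (1 - ε) * M ≤ supBallR h R x :=
    hz.le.trans (le_supBallR hbdd ((norm_sub_le _ _).trans (by linarith)))
  refine le_trans (le_of_eq ?_) (le_ite_tail (by positivity) hD h1)
  have : (1 - ε) ≠ 0 := by linarith
  congr 2
  field_simp

lemma eventually_lintegral_tail_le (hd : 1 ≤ d) (hξ : 0 < ξ) (hRV : RegVaryTail G ξ)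
    (hpos : ∀ x, 0 ≤ h x) (hbdd : BddAbove (Set.range h)) (hM : 0 < sSup (Set.range h))
    {γ C : ℝ} (hγ : (d : ℝ) / ξ < γ) (hC : 0 < C)
    (hdecay : ∀ x, x ≠ 0 → h x ≤ C * ‖x‖ ^ (-γ)) (hu : 0 < u) {ε : ℝ} (hε : 0 < ε) :
    ∃ c : ℝ, 0 < c ∧ ∃ K : ℝ≥0∞, K ≠ ∞ ∧ ∀ᶠ R : ℝ in atTop,
      (∫⁻ x, if supBallR h R x = 0 then 0
          else G (Set.Ioi (aScale G (R ^ d) * sSup (Set.range h) * u / supBallR h R x))) ≤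
        G (Set.Ioi (u * aScale G (R ^ d))) *
            volume (Metric.ball (0 : EuclideanSpace ℝ (Fin d)) ((1 + ε) * R + 0)) +
          G (Set.Ioi (c * aScale G (R ^ d))) * K := by
  set M := sSup (Set.range h)
  have hd0 : (0 : ℝ) < d := by exact_mod_cast hd
  have hγ0 : 0 < γ := (by positivity : 0 < (d : ℝ) / ξ).trans hγ
  obtain ⟨η, hη, hηξ⟩ := exists_between ((div_lt_comm₀ hξ hγ0).1 hγ)
  have hη0 : 0 < η := (by positivity : 0 < (d : ℝ) / γ).trans hη
  set κ := ε / (2 * (1 + ε))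
  have hκ : 0 < κ := by positivity
  set c := M * u * κ ^ γ / C
  have hc : 0 < c := by positivity
  set J := ∫⁻ x : EuclideanSpace ℝ (Fin d), ENNReal.ofReal ((1 + ‖x‖) ^ (-(γ * η)))
  have hJ : J < ∞ := finite_integral_one_add_norm (by
    rw [finrank_euclideanSpace_fin]
    rwa [div_lt_iff₀' hγ0] at hη)
  have ha' := hRV.tendsto_aScale.comp (tendsto_pow_atTop (α := ℝ) (Nat.one_le_iff_ne_zero.1 hd))
  refine ⟨c, hc, ENNReal.ofReal (2 ^ η) * J, ENNReal.mul_ne_top ENNReal.ofReal_ne_top hJ.ne, ?_⟩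
  filter_upwards [ha'.eventually_gt_atTop 0, eventually_ge_atTop 1,
    (ha'.const_mul_atTop hc).eventually (hRV.exists_potter_bound hη0 hηξ)] with R ha hR hP
  simp only [Function.comp_apply] at ha hP
  set a := aScale G (R ^ d)
  set B := Metric.ball (0 : EuclideanSpace ℝ (Fin d)) ((1 + ε) * R + 0)
  have key (x : EuclideanSpace ℝ (Fin d)) :
      (if supBallR h R x = 0 then 0 else G (Set.Ioi (a * M * u / supBallR h R x))) ≤
        B.indicator (fun _ => G (Set.Ioi (u * a))) x +
          G (Set.Ioi (c * a)) * (ENNReal.ofReal (2 ^ η) *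
            ENNReal.ofReal ((1 + ‖x‖) ^ (-(γ * η)))) := by
    by_cases hx : x ∈ B
    · rw [Set.indicator_of_mem hx]
      refine le_add_right ((ite_tail_le (by positivity) (supBallR_nonneg hpos R x)
        (supBallR_le (by linarith) fun z _ => le_csSup hbdd ⟨x + z, rfl⟩)).trans_eq ?_)
      congr 2
      change a * M * u / M = u * a
      field_simp
    · rw [Set.indicator_of_notMem hx, zero_add]
      rw [mem_ball_zero_iff, not_lt, add_zero] at hx
      have hκx : κ * (1 + ‖x‖) ≤ ‖x‖ - R := by
        have h1 : κ * (2 * (1 + ε)) = ε := by simp only [κ]; field_simp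
        have h2 : 1 ≤ ‖x‖ := by nlinarith
        have h3 : (1 + ε) * (κ * (1 + ‖x‖)) ≤ (1 + ε) * (‖x‖ - R) := by nlinarith
        exact le_of_mul_le_mul_left h3 (by linarith)
      have hx0 : 0 < 1 + ‖x‖ := by positivity
      refine (ite_tail_le (by positivity) (supBallR_nonneg hpos R x)
        (supBallR_le_rpow (by linarith) hγ0.le hC.le hdecay (by positivity) hκx)).trans ?_
      have h4 : a * M * u / (C * (κ * (1 + ‖x‖)) ^ (-γ)) = (1 + ‖x‖) ^ γ * (c * a) := by
        rw [Real.rpow_neg (by positivity), Real.mul_rpow hκ.le hx0.le]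
        simp only [c]
        field_simp
      have h5 := hP ((1 + ‖x‖) ^ γ) (Real.one_le_rpow (by linarith [norm_nonneg x]) hγ0.le)
      rw [h4, ← ofReal_real_Ioi, ← ofReal_real_Ioi, ← ENNReal.ofReal_mul (by positivity),
        ← ENNReal.ofReal_mul measureReal_nonneg]
      refine ENNReal.ofReal_le_ofReal (h5.trans_eq ?_)
      rw [← Real.rpow_mul hx0.le, mul_neg]
      ring
  refine (lintegral_mono key).trans_eq ?_
  have hmeas : Measurable fun x : EuclideanSpace ℝ (Fin d) =>
      ENNReal.ofReal ((1 + ‖x‖) ^ (-(γ * η))) := by fun_prop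
  rw [lintegral_add_left (measurable_const.indicator measurableSet_ball),
    lintegral_indicator_const measurableSet_ball,
    lintegral_const_mul _ (hmeas.const_mul _), lintegral_const_mul _ hmeas]

end Bounds

/-- Analytic content of Theorem 3.7: if `Ḡ ∈ RV_{-ξ}` and `h` satisfies (C'_ξ)
(i.e. `h(x) ≤ C min(‖x‖^{-γ},1)` for some `γ > d/ξ`, `C > 0`), then for every `u > 0`,
`∫ Ḡ(a_{R^d} ‖h‖_∞ u / h_R(x)) dx → c_d u^{-ξ}` as `R → ∞`, with the convention that
the integrand vanishes where `h_R(x) = 0`; here `c_d` is the volume of the unit ball. -/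
theorem sup_over_large_balls_limit
    {d : ℕ} (hd : 1 ≤ d) (ξ : ℝ) (hξ : 0 < ξ)
    (G : Measure ℝ) [IsProbabilityMeasure G] (hG0 : G (Set.Iic (0 : ℝ)) = 0)
    (hRV : RegVaryTail G ξ)
    (h : EuclideanSpace ℝ (Fin d) → ℝ) (hmeas : Measurable h) (hpos : ∀ x, 0 ≤ h x)
    (hne : ∃ x, h x ≠ 0)
    (hC' : ∃ γ C : ℝ, (d : ℝ) / ξ < γ ∧ 0 < C ∧ (∀ x, h x ≤ C) ∧
      ∀ x, x ≠ 0 → h x ≤ C * ‖x‖ ^ (-γ))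
    (u : ℝ) (hu : 0 < u) :
    Tendsto
      (fun R : ℝ => ∫⁻ x,
        if supBallR h R x = 0 then 0
        else G (Set.Ioi (aScale G (R ^ d) * sSup (Set.range h) * u / supBallR h R x)))
      atTop
      (nhds (volume (Metric.ball (0 : EuclideanSpace ℝ (Fin d)) 1) *
        ENNReal.ofReal (u ^ (-ξ)))) := by
  obtain ⟨γ, C, hγ, hC, hle, hdecay⟩ := hC'
  have hbdd : BddAbove (Set.range h) := ⟨C, by rintro _ ⟨x, rfl⟩; exact hle x⟩
  have hM : 0 < sSup (Set.range h) := by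
    obtain ⟨x, hx⟩ := hne
    exact (lt_of_le_of_ne (hpos x) hx.symm).trans_le (le_csSup hbdd ⟨x, rfl⟩)
  have hsmall : ∀ᶠ ε : ℝ in 𝓝[>] 0, ε ∈ Set.Ioo (0 : ℝ) 1 := Ioo_mem_nhdsGT one_pos
  choose! c hlo using fun (ε : ℝ) (hε : ε ∈ Set.Ioo (0 : ℝ) 1) =>
    eventually_le_lintegral_tail hd hRV hbdd hM hu hε.1 hε.2
  choose! c' hc' K hK hup using fun (ε : ℝ) (hε : ε ∈ Set.Ioo (0 : ℝ) 1) =>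
    eventually_lintegral_tail_le hd hξ hRV hpos hbdd hM hγ hC hdecay hu hε.1
  have hlim {f : ℝ → ℝ} (hf : ContinuousAt f 0) (hf0 : f 0 = u ^ (-ξ)) :
      Tendsto (fun ε => volume (Metric.ball (0 : EuclideanSpace ℝ (Fin d)) 1) *
        ENNReal.ofReal (f ε)) (𝓝[>] 0)
        (𝓝 (volume (Metric.ball (0 : EuclideanSpace ℝ (Fin d)) 1) *
          ENNReal.ofReal (u ^ (-ξ)))) := by
    rw [← hf0]
    exact ENNReal.Tendsto.const_mul
      (ENNReal.tendsto_ofReal (hf.tendsto.mono_left nhdsWithin_le_nhds))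
      (Or.inr measure_ball_lt_top.ne)
  refine tendsto_of_family_bounds (F := 𝓝[>] (0 : ℝ)) (hsmall.mono hlo)
    (hsmall.mono fun ε hε => hRV.tendsto_tail_mul_volume_ball hd
      (div_pos hu (by linarith [hε.2])) one_pos (c ε))
    (hlim (f := fun ε => 1 ^ d * (u / (1 - ε)) ^ (-ξ)) ?_ (by simp))
    (hsmall.mono hup)
    (q := fun ε => volume (Metric.ball (0 : EuclideanSpace ℝ (Fin d)) 1) *
      ENNReal.ofReal ((1 + ε) ^ d * u ^ (-ξ)))
    (hsmall.mono fun ε hε => ?_)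
    (hlim (f := fun ε => (1 + ε) ^ d * u ^ (-ξ)) (by fun_prop) (by simp))
  · refine continuousAt_const.mul (ContinuousAt.rpow_const
      (ContinuousAt.div (by fun_prop) (by fun_prop) (by simp)) (Or.inl (by simp [hu.ne'])))
  · have h1 := hRV.tendsto_tail_mul_volume_ball hd hu (s := 1 + ε) (by linarith [hε.1]) 0
    have h2 : Tendsto (fun R : ℝ => c' ε * aScale G (R ^ d)) atTop atTop :=
      (hRV.tendsto_aScale.comp
        (tendsto_pow_atTop (Nat.one_le_iff_ne_zero.1 hd))).const_mul_atTop (hc' ε hε)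
    have h3 := ENNReal.Tendsto.mul_const (b := K ε)
      (ENNReal.tendsto_ofReal ((tendsto_real_Ioi_atTop G).comp h2)) (Or.inr (hK ε hε))
    simp only [Function.comp_apply, ofReal_real_Ioi, ENNReal.ofReal_zero, zero_mul] at h3
    simpa using h1.add h3
end
end

section
/- Let d ≥ 1, let G be the standard exponential distribution on (0,+∞), i.e. Ḡ(u) = e^{−u} for u > 0, and let h : ℝ^d → [0,+∞) be bounded and measurable. Suppose there are functions γ⁻, γ⁺ : [0,+∞) → [0,+∞) with γ⁻(r) → γ and γ⁺(r) → γ as r → +∞ for some γ ∈ [0,+∞], and such that for all x with ‖x‖ large enough, γ⁻(‖x‖)/ln(‖x‖) ≤ h(x) ≤ γ⁺(‖x‖)/ln(‖x‖). Then α(h,G) = γ·d. -/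
open MeasureTheory ENNReal Filter

noncomputable section

variable {E : Type*} [NormedAddCommGroup E] [MeasureSpace E]

theorem tailIntegrand_ofReal_of_pos {X : Type*} {G : Measure ℝ}
    (hG : ∀ u : ℝ, 0 < u → G (Set.Ioi u) = ENNReal.ofReal (Real.exp (-u)))
    {h : X → ℝ} {u : ℝ} (hu : 0 < u) {x : X} (hx : 0 < h x) :
    tailIntegrand G (fun x => ENNReal.ofReal (h x)) u x =
      ENNReal.ofReal (Real.exp (-(u / h x))) := by
  have h0 : ENNReal.ofReal (h x) ≠ 0 := by simpa using hx
  simp only [tailIntegrand, h0, ENNReal.ofReal_ne_top, if_false]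
  rw [ENNReal.toReal_ofReal hx.le, hG _ (by positivity)]

theorem lintegral_norm_rpow_neg_finrank_eq_top [NormedSpace ℝ E] [FiniteDimensional ℝ E]
    [BorelSpace E] [Nontrivial E] [(volume : Measure E).IsAddHaarMeasure] {R : ℝ} (hR : 0 < R) :
    ∫⁻ x : E, Set.indicator {x : E | R < ‖x‖}
      (fun x => ENNReal.ofReal (‖x‖ ^ (-(Module.finrank ℝ E : ℝ)))) x = ⊤ := by
  by_contra hne
  let f : ℝ → ℝ := (Set.Ioi R).indicator fun y => y ^ (-(Module.finrank ℝ E : ℝ))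
  have hfm : Measurable f :=
    (measurable_id.pow_const _).indicator measurableSet_Ioi
  have hf0 : ∀ y, 0 ≤ f y := fun y =>
    Set.indicator_nonneg (fun y hy => Real.rpow_nonneg (hR.trans hy).le _) y
  have hint : Integrable (fun x : E => f ‖x‖) := by
    refine ⟨(hfm.comp measurable_norm).aestronglyMeasurable, ?_⟩
    rw [hasFiniteIntegral_iff_ofReal (ae_of_all _ fun x => hf0 _)]
    refine lt_of_le_of_lt (lintegral_mono fun x => ?_) (lt_top_iff_ne_top.2 hne)
    by_cases hx : R < ‖x‖ <;> simp [f, Set.indicator, hx]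
  rw [integrable_fun_norm_addHaar] at hint
  refine not_integrableOn_Ioi_inv (a := R) ?_
  refine (hint.mono_set (Set.Ioi_subset_Ioi hR.le)).congr_fun (fun y hy => ?_) measurableSet_Ioi
  have hy0 : 0 < y := hR.trans hy
  have hn : 1 ≤ Module.finrank ℝ E := Module.finrank_pos
  simp only [f, Set.indicator_of_mem hy, smul_eq_mul]
  rw [Real.rpow_neg hy0.le, Real.rpow_natCast]
  obtain ⟨n, hn⟩ := Nat.exists_eq_add_of_le' hn
  rw [hn, Nat.add_sub_cancel]
  field_simp
  exact (pow_succ y n).symm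

theorem lintegral_tailIntegrand_lt_top [NormedSpace ℝ E] [FiniteDimensional ℝ E]
    [BorelSpace E] [(volume : Measure E).IsAddHaarMeasure] {G : Measure ℝ}
    (hG : ∀ u : ℝ, 0 < u → G (Set.Ioi u) = ENNReal.ofReal (Real.exp (-u)))
    {h : E → ℝ} (hpos : ∀ x, 0 ≤ h x) {u c R : ℝ} (hc : 0 < c)
    (huc : Module.finrank ℝ E * c < u) (hR : 1 < R)
    (hle : ∀ x, R < ‖x‖ → h x ≤ c / Real.log ‖x‖) :
    ∫⁻ x, tailIntegrand G (fun x => ENNReal.ofReal (h x)) u x < ⊤ := by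
  have hu : 0 < u := lt_of_le_of_lt (by positivity) huc
  set p := u / c
  have hp : 0 < p := div_pos hu hc
  have hfin : ∫⁻ x : E, ENNReal.ofReal ((1 + ‖x‖) ^ (-p)) < ⊤ :=
    finite_integral_one_add_norm ((lt_div_iff₀ hc).2 huc)
  refine lt_of_le_of_lt (lintegral_mono (g := fun x : E =>
    ENNReal.ofReal ((1 + R) ^ p) * ENNReal.ofReal ((1 + ‖x‖) ^ (-p))) fun x => ?_) ?_
  · rcases (hpos x).eq_or_lt with hx | hx
    · simp [tailIntegrand, ← hx]
    simp only
    rw [tailIntegrand_ofReal_of_pos hG hu hx, ← ENNReal.ofReal_mul (by positivity)]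
    refine ENNReal.ofReal_le_ofReal ?_
    rw [Real.rpow_neg (by positivity), ← div_eq_mul_inv, le_div_iff₀ (by positivity)]
    rcases le_or_gt ‖x‖ R with hxR | hxR
    · calc Real.exp (-(u / h x)) * (1 + ‖x‖) ^ p ≤ 1 * (1 + R) ^ p := by
            gcongr
            exact Real.exp_le_one_iff.2 (neg_nonpos.2 (by positivity))
        _ = _ := one_mul _
    · have hx1 : 1 < ‖x‖ := hR.trans hxR
      have hx0 : 0 < ‖x‖ := by linarith
      have hlog : 0 < Real.log ‖x‖ := Real.log_pos hx1
      have hexp : Real.exp (-(u / h x)) ≤ ‖x‖ ^ (-p) := by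
        rw [Real.rpow_def_of_pos hx0, Real.exp_le_exp, mul_neg, neg_le_neg_iff]
        have := (le_div_iff₀ hlog).1 (hle x hxR)
        rw [mul_div_assoc', div_le_div_iff₀ hc hx]
        nlinarith
      calc Real.exp (-(u / h x)) * (1 + ‖x‖) ^ p
          ≤ ‖x‖ ^ (-p) * ((1 + R) * ‖x‖) ^ p := by
            gcongr
            nlinarith
        _ = (1 + R) ^ p := by
            rw [Real.mul_rpow (by positivity) hx0.le, Real.rpow_neg hx0.le]
            field_simp
  · rw [lintegral_const_mul' _ _ ENNReal.ofReal_ne_top]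
    exact ENNReal.mul_lt_top ENNReal.ofReal_lt_top hfin

theorem lintegral_tailIntegrand_eq_top [NormedSpace ℝ E] [FiniteDimensional ℝ E]
    [BorelSpace E] [Nontrivial E] [(volume : Measure E).IsAddHaarMeasure] {G : Measure ℝ}
    (hG : ∀ u : ℝ, 0 < u → G (Set.Ioi u) = ENNReal.ofReal (Real.exp (-u)))
    {h : E → ℝ} {u c R : ℝ} (hu : 0 < u) (huc : u ≤ Module.finrank ℝ E * c) (hR : 1 < R)
    (hle : ∀ x, R < ‖x‖ → c / Real.log ‖x‖ ≤ h x) :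
    ∫⁻ x, tailIntegrand G (fun x => ENNReal.ofReal (h x)) u x = ⊤ := by
  have hc : 0 < c := pos_of_mul_pos_right (hu.trans_le huc) (by positivity)
  rw [eq_top_iff, ← lintegral_norm_rpow_neg_finrank_eq_top (E := E) (zero_lt_one.trans hR)]
  refine lintegral_mono fun x => Set.indicator_le' (fun x hx => ?_) (fun _ _ => zero_le) x
  have hx1 : 1 < ‖x‖ := hR.trans hx
  have hx0 : 0 < ‖x‖ := by linarith
  have hlog : 0 < Real.log ‖x‖ := Real.log_pos hx1
  have hhx : 0 < h x := (div_pos hc hlog).trans_le (hle x hx)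
  rw [tailIntegrand_ofReal_of_pos hG hu hhx]
  refine ENNReal.ofReal_le_ofReal ?_
  rw [Real.rpow_def_of_pos hx0, Real.exp_le_exp, mul_neg, neg_le_neg_iff, div_le_iff₀ hhx]
  have := (div_le_iff₀ hlog).1 (hle x hx)
  nlinarith [(Nat.cast_nonneg (Module.finrank ℝ E) : (0 : ℝ) ≤ _)]

/-- Example 2.2: for the standard exponential distribution `Ḡ(u) = e^{-u}` and a bounded
shape function `h` with `γ⁻(‖x‖)/ln‖x‖ ≤ h(x) ≤ γ⁺(‖x‖)/ln‖x‖` for large `‖x‖`, where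
`γ⁻(r), γ⁺(r) → γ ∈ [0,∞]`, one has `α(h,G) = γ·d`. -/
theorem alpha_exponential_log_decay
    {d : ℕ} (hd : 1 ≤ d) (G : Measure ℝ)
    (hG : ∀ u : ℝ, 0 < u → G (Set.Ioi u) = ENNReal.ofReal (Real.exp (-u)))
    (h : EuclideanSpace ℝ (Fin d) → ℝ) (hmeas : Measurable h) (hpos : ∀ x, 0 ≤ h x)
    (hbdd : ∃ B : ℝ, ∀ x, h x ≤ B)
    (γ : ℝ≥0∞) (γm γp : ℝ → ℝ) (hγm0 : ∀ r, 0 ≤ r → 0 ≤ γm r) (hγp0 : ∀ r, 0 ≤ r → 0 ≤ γp r)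
    (hγm : Tendsto (fun r => ENNReal.ofReal (γm r)) atTop (nhds γ))
    (hγp : Tendsto (fun r => ENNReal.ofReal (γp r)) atTop (nhds γ))
    (hsandwich : ∃ R : ℝ, 1 < R ∧ ∀ x : EuclideanSpace ℝ (Fin d), R < ‖x‖ →
      γm ‖x‖ / Real.log ‖x‖ ≤ h x ∧ h x ≤ γp ‖x‖ / Real.log ‖x‖) :
    alphaCoef G (fun x => ENNReal.ofReal (h x)) = γ * d := by
  obtain ⟨R, hR, hsand⟩ := hsandwich
  have hd0 : (0 : ℝ) < d := by exact_mod_cast hd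
  have : Nonempty (Fin d) := ⟨⟨0, hd⟩⟩
  apply le_antisymm
  · refine le_of_forall_gt_imp_ge_of_dense fun v hv => ?_
    obtain ⟨u, hu, huv⟩ := ENNReal.lt_iff_exists_nnreal_btwn.1 hv
    have hdE : (d : ℝ≥0∞) ≠ 0 := by exact_mod_cast (by omega : d ≠ 0)
    have hγu : γ < u / d := by
      rwa [ENNReal.lt_div_iff_mul_lt (Or.inl hdE) (Or.inl (ENNReal.natCast_ne_top d))]
    obtain ⟨c, hγc, hcu⟩ := ENNReal.lt_iff_exists_nnreal_btwn.1 hγu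
    have hc : (0 : ℝ) < c := by
      exact_mod_cast zero_le.trans_lt hγc
    have huc : (d : ℝ) * c < u := by
      rw [ENNReal.lt_div_iff_mul_lt (Or.inl hdE) (Or.inl (ENNReal.natCast_ne_top d))] at hcu
      rw [mul_comm]
      exact_mod_cast hcu
    obtain ⟨S, hS⟩ := eventually_atTop.1 (hγp.eventually_lt_const hγc)
    refine le_trans (sInf_le ⟨u, ⟨(by positivity : (0 : ℝ) < d * c).trans huc, ?_⟩, rfl⟩)
      (by simpa using huv.le)
    refine lintegral_tailIntegrand_lt_top hG hpos (R := max R S) hc (by simpa using huc)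
      (hR.trans_le (le_max_left _ _)) fun x hx => ?_
    obtain ⟨hxR, hxS⟩ := max_lt_iff.1 hx
    have hlog : 0 < Real.log ‖x‖ := Real.log_pos (hR.trans hxR)
    refine (hsand x hxR).2.trans (div_le_div_of_nonneg_right ?_ hlog.le)
    have := hS ‖x‖ hxS.le
    rw [← ENNReal.ofReal_coe_nnreal, ENNReal.ofReal_lt_ofReal_iff hc] at this
    exact this.le
  · refine le_sInf ?_
    rintro _ ⟨u, ⟨hu, hfin⟩, rfl⟩
    by_contra! hlt
    have hγ : ENNReal.ofReal (u / d) < γ := by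
      rw [ENNReal.ofReal_div_of_pos hd0, ENNReal.ofReal_natCast]
      exact ENNReal.div_lt_of_lt_mul hlt
    obtain ⟨S, hS⟩ := eventually_atTop.1 (hγm.eventually_const_lt hγ)
    refine hfin.ne (lintegral_tailIntegrand_eq_top hG (R := max R S) (c := u / d) hu
      (by simp [mul_div_cancel₀ _ hd0.ne']) (hR.trans_le (le_max_left _ _)) fun x hx => ?_)
    obtain ⟨hxR, hxS⟩ := max_lt_iff.1 hx
    have hlog : 0 < Real.log ‖x‖ := Real.log_pos (hR.trans hxR)
    refine le_trans (div_le_div_of_nonneg_right ?_ hlog.le) (hsand x hxR).1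
    exact (ENNReal.ofReal_lt_ofReal_iff_of_nonneg (by positivity)).1 (hS ‖x‖ hxS.le) |>.le
end
end

section
/- Let d = 1, let G be the standard exponential distribution on (0,+∞), i.e. Ḡ(u) = e^{−u} for u > 0, let γ > 0, let A = [−1,1], and define h(x) = Σ_{n≥1} (γ/(1+ln(1+|x|)))·1_{{n < |x| < n + n^{−2}}} for x ∈ ℝ. Then α(h,G) = 0 while α(h_A,G) = γ; in particular the inequality α(h,G) ≤ α(h_A,G) can be strict. -/
open MeasureTheory ENNReal Filter

noncomputable section

variable {E : Type*} [NormedAddCommGroup E] [MeasureSpace E]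

/-- The shape function of Example 2.4/2.5:
`h(x) = Σ_{n≥1} (γ(|x|)/(1+ln(1+|x|)))·1_{n < |x| < n+n⁻²}`. -/
def exShape (g : ℝ → ℝ) (x : ℝ) : ℝ :=
  ∑' n : ℕ, if 1 ≤ n ∧ (n : ℝ) < |x| ∧ |x| < n + ((n : ℝ) ^ 2)⁻¹
    then g |x| / (1 + Real.log (1 + |x|)) else 0

theorem tailIntegrand_le_of_le {G : Measure ℝ}
    (hG : ∀ u : ℝ, 0 < u → G (Set.Ioi u) = ENNReal.ofReal (Real.exp (-u)))
    {h : ℝ → ℝ≥0∞} {u b x : ℝ} (hu : 0 < u) (hb : 0 < b) (hx : h x ≤ ENNReal.ofReal b) :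
    tailIntegrand G h u x ≤ ENNReal.ofReal (Real.exp (-(u / b))) := by
  unfold tailIntegrand
  have htop : h x ≠ ⊤ := ne_top_of_le_ne_top ENNReal.ofReal_ne_top hx
  split_ifs with h0
  · exact zero_le
  · have hpos : 0 < (h x).toReal := ENNReal.toReal_pos h0 htop
    have hle : (h x).toReal ≤ b := ENNReal.toReal_le_of_le_ofReal hb.le hx
    rw [← hG _ (div_pos hu hb)]
    exact measure_mono (Set.Ioi_subset_Ioi (by gcongr))

theorem le_tailIntegrand_of_le {G : Measure ℝ}
    (hG : ∀ u : ℝ, 0 < u → G (Set.Ioi u) = ENNReal.ofReal (Real.exp (-u)))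
    {h : ℝ → ℝ≥0∞} {u b x : ℝ} (hu : 0 < u) (hb : 0 < b) (hx : ENNReal.ofReal b ≤ h x) :
    ENNReal.ofReal (Real.exp (-(u / b))) ≤ tailIntegrand G h u x := by
  unfold tailIntegrand
  rw [← hG _ (div_pos hu hb)]
  split_ifs with h0 htop
  · rw [h0, nonpos_iff_eq_zero, ENNReal.ofReal_eq_zero] at hx
    exact absurd hx hb.not_ge
  · exact measure_mono (Set.Ioi_subset_Ioi (div_pos hu hb).le)
  · have hle : b ≤ (h x).toReal := (ENNReal.ofReal_le_iff_le_toReal htop).1 hx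
    exact measure_mono (Set.Ioi_subset_Ioi (by gcongr))

theorem alphaCoef_le_ofReal {G : Measure ℝ} {h : ℝ → ℝ≥0∞} {a : ℝ} (ha : 0 ≤ a)
    (H : ∀ u, a < u → (∫⁻ x, tailIntegrand G h u x) < ⊤) :
    alphaCoef G h ≤ ENNReal.ofReal a := by
  refine ENNReal.le_of_forall_pos_le_add fun ε hε _ => ?_
  have hε' : (0 : ℝ) < ε := hε
  rw [← ENNReal.ofReal_coe_nnreal, ← ENNReal.ofReal_add ha hε'.le]
  exact sInf_le ⟨a + ε, ⟨by linarith, H _ (by linarith)⟩, rfl⟩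

theorem ofReal_le_alphaCoef {G : Measure ℝ} {h : ℝ → ℝ≥0∞} {a : ℝ}
    (H : ∀ u, 0 < u → u < a → (∫⁻ x, tailIntegrand G h u x) = ⊤) :
    ENNReal.ofReal a ≤ alphaCoef G h := by
  refine le_sInf ?_
  rintro _ ⟨u, ⟨hu, hfin⟩, rfl⟩
  by_contra! hlt
  exact hfin.ne (H u hu (ENNReal.ofReal_lt_ofReal_iff'.1 hlt).1)

theorem exShape_eq_zero {g : ℝ → ℝ} {x : ℝ}
    (hx : ∀ n : ℕ, ¬ ((n : ℝ) < |x| ∧ |x| < n + ((n : ℝ) ^ 2)⁻¹)) : exShape g x = 0 := by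
  unfold exShape
  simp [hx]

theorem exShape_eq {g : ℝ → ℝ} {x : ℝ} {n : ℕ} (hn : 1 ≤ n) (h₁ : (n : ℝ) < |x|)
    (h₂ : |x| < n + ((n : ℝ) ^ 2)⁻¹) :
    exShape g x = g |x| / (1 + Real.log (1 + |x|)) := by
  have floor_eq : ∀ m : ℕ, 1 ≤ m → (m : ℝ) < |x| → |x| < m + ((m : ℝ) ^ 2)⁻¹ →
      ⌊|x|⌋₊ = m := by
    intro m hm hm₁ hm₂
    rw [Nat.floor_eq_iff (abs_nonneg x)]
    have hm' : (1 : ℝ) ≤ m := by exact_mod_cast hm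
    have : ((m : ℝ) ^ 2)⁻¹ ≤ 1 := inv_le_one_of_one_le₀ (one_le_pow₀ hm')
    exact ⟨hm₁.le, by linarith⟩
  unfold exShape
  rw [tsum_eq_single n, if_pos ⟨hn, h₁, h₂⟩]
  intro m hm
  refine if_neg ?_
  rintro ⟨hm₀, hm₁, hm₂⟩
  exact hm ((floor_eq m hm₀ hm₁ hm₂).symm.trans (floor_eq n hn h₁ h₂))

theorem one_le_one_add_log {t : ℝ} (ht : 1 ≤ t) : 1 ≤ 1 + Real.log t := by
  linarith [Real.log_nonneg ht]

theorem exShape_const_le {γ : ℝ} (hγ : 0 < γ) (x : ℝ) :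
    exShape (fun _ => γ) x ≤ γ / (1 + Real.log (1 + |x|)) := by
  by_cases hx : ∃ n : ℕ, (n : ℝ) < |x| ∧ |x| < n + ((n : ℝ) ^ 2)⁻¹
  · obtain ⟨n, h₁, h₂⟩ := hx
    have hn : 1 ≤ n := by
      rcases Nat.eq_zero_or_pos n with rfl | h
      · norm_num at h₂
        exact absurd h₂ (abs_nonneg x).not_gt
      · exact h
    exact (exShape_eq hn h₁ h₂).le
  · rw [exShape_eq_zero (by simpa only [not_exists] using hx)]
    have := one_le_one_add_log (t := 1 + |x|) (by linarith [abs_nonneg x])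
    positivity

theorem volume_iUnion_abs_mem_Ioo_lt_top :
    volume (⋃ n : ℕ, {x : ℝ | (n : ℝ) < |x| ∧ |x| < n + ((n : ℝ) ^ 2)⁻¹}) < ⊤ := by
  have hsum : Summable fun n : ℕ => 2 * ((n : ℝ) ^ 2)⁻¹ :=
    (Real.summable_nat_pow_inv.2 one_lt_two).mul_left 2
  refine (measure_iUnion_le _).trans_lt (lt_of_le_of_lt (ENNReal.tsum_le_tsum fun n => ?_)
    hsum.tsum_ofReal_lt_top)
  have hsub : {x : ℝ | (n : ℝ) < |x| ∧ |x| < n + ((n : ℝ) ^ 2)⁻¹} ⊆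
      Set.Ioo (n : ℝ) (n + ((n : ℝ) ^ 2)⁻¹) ∪ Set.Ioo (-(n + ((n : ℝ) ^ 2)⁻¹)) (-(n : ℝ)) := by
    rintro x ⟨h₁, h₂⟩
    rcases abs_cases x with ⟨hx, _⟩ | ⟨hx, _⟩ <;> rw [hx] at h₁ h₂
    · exact Or.inl ⟨h₁, h₂⟩
    · exact Or.inr ⟨by linarith, by linarith⟩
  refine (measure_mono hsub).trans ((measure_union_le _ _).trans ?_)
  rw [Real.volume_Ioo, Real.volume_Ioo, ← ENNReal.ofReal_add]
  · refine ENNReal.ofReal_le_ofReal (le_of_eq ?_)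
    ring
  · simp
  · simp

theorem lintegral_tailIntegrand_exShape_lt_top {G : Measure ℝ}
    (hG : ∀ u : ℝ, 0 < u → G (Set.Ioi u) = ENNReal.ofReal (Real.exp (-u)))
    {γ : ℝ} (hγ : 0 < γ) {u : ℝ} (hu : 0 < u) :
    (∫⁻ x, tailIntegrand G (fun x => ENNReal.ofReal (exShape (fun _ => γ) x)) u x) < ⊤ := by
  refine lt_of_le_of_lt (lintegral_mono fun x => ?_)
    ((lintegral_indicator_one_le _).trans_lt volume_iUnion_abs_mem_Ioo_lt_top)
  by_cases hx : x ∈ ⋃ n : ℕ, {x : ℝ | (n : ℝ) < |x| ∧ |x| < n + ((n : ℝ) ^ 2)⁻¹}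
  · rw [Set.indicator_of_mem hx]
    have hlog := one_le_one_add_log (t := 1 + |x|) (by linarith [abs_nonneg x])
    have hb : 0 < γ / (1 + Real.log (1 + |x|)) := by positivity
    refine (tailIntegrand_le_of_le hG hu hb
      (ENNReal.ofReal_le_ofReal (exShape_const_le hγ x))).trans ?_
    rw [Pi.one_apply, ENNReal.ofReal_le_one, Real.exp_le_one_iff, neg_nonpos]
    positivity
  · rw [Set.indicator_of_notMem hx, nonpos_iff_eq_zero]
    simp only [Set.mem_iUnion, not_exists, Set.mem_ofPred_eq] at hx
    simp [tailIntegrand, exShape_eq_zero hx]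

theorem exp_neg_div_div_one_add_log {γ u t : ℝ} (ht : 0 < t) :
    Real.exp (-(u / (γ / (1 + Real.log t)))) = Real.exp (-(u / γ)) * t ^ (-(u / γ)) := by
  rw [Real.rpow_def_of_pos ht, ← Real.exp_add, div_div_eq_mul_div]
  congr 1
  ring

theorem supOver_exShape_le {γ : ℝ} (hγ : 0 < γ) (x : ℝ) :
    supOver (fun x => ENNReal.ofReal (exShape (fun _ => γ) x)) (Set.Icc (-1 : ℝ) 1) x ≤
      ENNReal.ofReal (γ / (1 + Real.log (max |x| 1))) := by
  refine iSup₂_le fun z hz => ENNReal.ofReal_le_ofReal ((exShape_const_le hγ _).trans ?_)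
  have hlog := one_le_one_add_log (le_max_right |x| 1)
  have hz' : |z| ≤ 1 := abs_le.2 hz
  have htri : |x| ≤ |x + z| + |z| := by simpa using abs_sub (x + z) z
  have hmax : max |x| 1 ≤ 1 + |x + z| :=
    max_le (by linarith) (by linarith [abs_nonneg (x + z)])
  gcongr

theorem le_supOver_exShape {γ : ℝ} (hγ : 0 < γ) {x : ℝ} (hx : 1 ≤ x) :
    ENNReal.ofReal (γ / (1 + Real.log (3 * x))) ≤
      supOver (fun x => ENNReal.ofReal (exShape (fun _ => γ) x)) (Set.Icc (-1 : ℝ) 1) x := by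
  have hn : 1 ≤ ⌊x⌋₊ := Nat.one_le_floor_iff x |>.2 hx
  have hle : (⌊x⌋₊ : ℝ) ≤ x := Nat.floor_le (by linarith)
  have hlt : x < ⌊x⌋₊ + 1 := Nat.lt_floor_add_one x
  generalize ⌊x⌋₊ = n at hn hle hlt
  have hn' : (1 : ℝ) ≤ n := by exact_mod_cast hn
  have hinv : ((n : ℝ) ^ 2)⁻¹ ≤ 1 := inv_le_one_of_one_le₀ (one_le_pow₀ hn')
  have hinv' : 0 < ((n : ℝ) ^ 2)⁻¹ := by positivity
  obtain ⟨y, hy⟩ : ∃ y : ℝ, y = n + ((n : ℝ) ^ 2)⁻¹ / 2 := ⟨_, rfl⟩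
  have habs : |y| = y := abs_of_pos (by linarith)
  have hshape : exShape (fun _ => γ) y = γ / (1 + Real.log (1 + y)) := by
    rw [exShape_eq hn (by rw [habs]; linarith) (by rw [habs]; linarith), habs]
  have hlog := one_le_one_add_log (t := 1 + y) (by linarith)
  refine le_trans ?_ (le_iSup₂_of_le (y - x) ⟨by linarith, by linarith⟩ le_rfl)
  beta_reduce
  rw [add_sub_cancel, hshape]
  refine ENNReal.ofReal_le_ofReal ?_
  gcongr <;> linarith

theorem lintegral_tailIntegrand_supOver_exShape_lt_top {G : Measure ℝ}
    (hG : ∀ u : ℝ, 0 < u → G (Set.Ioi u) = ENNReal.ofReal (Real.exp (-u)))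
    {γ : ℝ} (hγ : 0 < γ) {u : ℝ} (hu : γ < u) :
    (∫⁻ x, tailIntegrand G (supOver (fun x => ENNReal.ofReal (exShape (fun _ => γ) x))
      (Set.Icc (-1 : ℝ) 1)) u x) < ⊤ := by
  have hr : 1 < u / γ := (one_lt_div hγ).2 hu
  have hint : Integrable fun x : ℝ => (2 : ℝ) ^ (u / γ) * (1 + ‖x‖) ^ (-(u / γ)) :=
    (integrable_one_add_norm (by simpa using hr)).const_mul _
  refine lt_of_le_of_lt (lintegral_mono fun x => ?_) hint.lintegral_lt_top
  have hlog := one_le_one_add_log (le_max_right |x| 1)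
  have hmax : 0 < max |x| 1 := lt_max_of_lt_right one_pos
  refine (tailIntegrand_le_of_le hG (hγ.trans hu) (by positivity)
    (supOver_exShape_le hγ x)).trans (ENNReal.ofReal_le_ofReal ?_)
  rw [exp_neg_div_div_one_add_log hmax]
  have hexp : Real.exp (-(u / γ)) ≤ 1 := Real.exp_le_one_iff.2 (by linarith)
  have hbase : (1 + ‖x‖) / 2 ≤ max |x| 1 := by
    rw [Real.norm_eq_abs]
    linarith [le_max_left |x| 1, le_max_right |x| 1]
  have hpos : 0 < 1 + ‖x‖ := by positivity
  calc Real.exp (-(u / γ)) * max |x| 1 ^ (-(u / γ))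
      ≤ 1 * ((1 + ‖x‖) / 2) ^ (-(u / γ)) := by
        refine mul_le_mul hexp ?_ (by positivity) zero_le_one
        exact Real.rpow_le_rpow_of_nonpos (by positivity) hbase (by linarith)
    _ = 2 ^ (u / γ) * (1 + ‖x‖) ^ (-(u / γ)) := by
        rw [one_mul, Real.div_rpow hpos.le zero_le_two, Real.rpow_neg zero_le_two, div_inv_eq_mul,
          mul_comm]

theorem lintegral_tailIntegrand_supOver_exShape_eq_top {G : Measure ℝ}
    (hG : ∀ u : ℝ, 0 < u → G (Set.Ioi u) = ENNReal.ofReal (Real.exp (-u)))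
    {γ : ℝ} (hγ : 0 < γ) {u : ℝ} (hu : 0 < u) (huγ : u ≤ γ) :
    (∫⁻ x, tailIntegrand G (supOver (fun x => ENNReal.ofReal (exShape (fun _ => γ) x))
      (Set.Icc (-1 : ℝ) 1)) u x) = ⊤ := by
  have hr : u / γ ≤ 1 := (div_le_one hγ).2 huγ
  by_contra hfin
  refine not_integrableOn_Ioi_inv (a := (1 : ℝ)) ?_
  have hc : Real.exp (-(u / γ)) * 3⁻¹ ≠ 0 := by positivity
  refine (integrable_const_mul_iff (IsUnit.mk0 _ hc) _).1 ?_
  refine ⟨by fun_prop, ?_⟩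
  rw [hasFiniteIntegral_iff_ofReal]
  · refine lt_of_le_of_lt ?_ (lt_top_iff_ne_top.2 hfin)
    refine (setLIntegral_mono' measurableSet_Ioi fun x hx => ?_).trans (setLIntegral_le_lintegral _ _)
    have hx1 : (1 : ℝ) < x := hx
    have hlog := one_le_one_add_log (t := 3 * x) (by linarith)
    refine le_trans (ENNReal.ofReal_le_ofReal ?_)
      (le_tailIntegrand_of_le hG hu (by positivity) (le_supOver_exShape hγ hx1.le))
    rw [exp_neg_div_div_one_add_log (by positivity), mul_assoc, ← mul_inv,
      ← Real.rpow_neg_one (3 * x)]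
    gcongr
    linarith
  · refine (ae_restrict_iff' measurableSet_Ioi).2 (ae_of_all _ fun x hx => ?_)
    have hx1 : (1 : ℝ) < x := hx
    change 0 ≤ Real.exp (-(u / γ)) * 3⁻¹ * x⁻¹
    positivity

/-- Example 2.4: for `Ḡ(u) = e^{-u}`, `A = [-1,1]` and
`h(x) = Σ_{n≥1} (γ/(1+ln(1+|x|)))·1_{n < |x| < n+n⁻²}`, one has `α(h,G) = 0` and
`α(h_A,G) = γ`; in particular `α(h,G) ≤ α(h_A,G)` can be strict. -/
theorem alpha_strict_example
    (G : Measure ℝ)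
    (hG : ∀ u : ℝ, 0 < u → G (Set.Ioi u) = ENNReal.ofReal (Real.exp (-u)))
    (γ : ℝ) (hγ : 0 < γ) :
    alphaCoef G (fun x => ENNReal.ofReal (exShape (fun _ => γ) x)) = 0 ∧
    alphaCoef G (supOver (fun x => ENNReal.ofReal (exShape (fun _ => γ) x))
      (Set.Icc (-1 : ℝ) 1)) = ENNReal.ofReal γ ∧
    alphaCoef G (fun x => ENNReal.ofReal (exShape (fun _ => γ) x)) <
      alphaCoef G (supOver (fun x => ENNReal.ofReal (exShape (fun _ => γ) x))
        (Set.Icc (-1 : ℝ) 1)) := by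
  have h₁ : alphaCoef G (fun x => ENNReal.ofReal (exShape (fun _ => γ) x)) = 0 := by
    simpa using alphaCoef_le_ofReal le_rfl
      fun u hu => lintegral_tailIntegrand_exShape_lt_top hG hγ hu
  have h₂ : alphaCoef G (supOver (fun x => ENNReal.ofReal (exShape (fun _ => γ) x))
      (Set.Icc (-1 : ℝ) 1)) = ENNReal.ofReal γ :=
    le_antisymm
      (alphaCoef_le_ofReal hγ.le
        fun u hu => lintegral_tailIntegrand_supOver_exShape_lt_top hG hγ hu)
      (ofReal_le_alphaCoef
        fun u hu huγ => lintegral_tailIntegrand_supOver_exShape_eq_top hG hγ hu huγ.le)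
  refine ⟨h₁, h₂, ?_⟩
  rw [h₁, h₂]
  exact ENNReal.ofReal_pos.2 hγ
end
end

section
/- Let d = 1, let G be the standard exponential distribution on (0,+∞), i.e. Ḡ(u) = e^{−u} for u > 0, let γ : [0,+∞) → [0,+∞) be nondecreasing with γ(u) → +∞ and γ(u)/ln(u) → 0 as u → +∞, and define h(x) = Σ_{n≥1} (γ(|x|)/(1+ln(1+|x|)))·1_{{n < |x| < n + n^{−2}}} for x ∈ ℝ. Then α(h,G) = 0 and α⁺(h,G) = +∞. -/
open MeasureTheory ENNReal Filter

noncomputable section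

variable {E : Type*} [NormedAddCommGroup E] [MeasureSpace E]

/-- The annulus `n < |x| < n + n⁻²` on the real line. -/
def annulus (n : ℕ) : Set ℝ :=
  Set.Ioo (n : ℝ) (n + ((n : ℝ) ^ 2)⁻¹) ∪ Set.Ioo (-(n + ((n : ℝ) ^ 2)⁻¹)) (-(n : ℝ))

theorem measurableSet_annulus (n : ℕ) : MeasurableSet (annulus n) :=
  measurableSet_Ioo.union measurableSet_Ioo

theorem volume_iUnion_annulus_lt_top : volume (⋃ n, annulus n) < ⊤ := by
  have hsum : Summable fun n : ℕ => 2 * ((n : ℝ) ^ 2)⁻¹ :=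
    (Real.summable_nat_pow_inv.2 one_lt_two).mul_left 2
  refine (measure_iUnion_le _).trans_lt (lt_of_le_of_lt (ENNReal.tsum_le_tsum fun n => ?_)
    hsum.tsum_ofReal_lt_top)
  refine (measure_union_le _ _).trans ?_
  rw [Real.volume_Ioo, Real.volume_Ioo, ← ENNReal.ofReal_add]
  · apply ENNReal.ofReal_le_ofReal
    linarith
  all_goals
    have : 0 ≤ ((n : ℝ) ^ 2)⁻¹ := by positivity
    linarith

theorem mem_iUnion_annulus_of_exShape_ne_zero {g : ℝ → ℝ} {x : ℝ} (hx : exShape g x ≠ 0) :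
    x ∈ ⋃ n, annulus n := by
  by_contra hmem
  refine hx ((tsum_congr fun n => if_neg ?_).trans tsum_zero)
  rintro ⟨-, h1, h2⟩
  refine hmem (Set.mem_iUnion.2 ⟨n, ?_⟩)
  rcases abs_cases x with ⟨h, -⟩ | ⟨h, -⟩ <;> rw [h] at h1 h2
  · exact Or.inl ⟨h1, h2⟩
  · exact Or.inr ⟨by linarith, by linarith⟩

theorem exShape_eq_of_mem {g : ℝ → ℝ} {n : ℕ} (hn : 1 ≤ n) {x : ℝ} (h1 : (n : ℝ) < x)
    (h2 : x < n + ((n : ℝ) ^ 2)⁻¹) : exShape g x = g x / (1 + Real.log (1 + x)) := by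
  have hx : |x| = x := abs_of_nonneg (n.cast_nonneg.trans h1.le)
  have key : ∀ m : ℕ, 1 ≤ m → ((m : ℝ) ^ 2)⁻¹ ≤ 1 := fun m hm =>
    inv_le_one_of_one_le₀ (one_le_pow₀ (by exact_mod_cast hm))
  rw [exShape, tsum_eq_single n, hx, if_pos ⟨hn, h1, h2⟩]
  rintro m hmn
  rw [hx]
  refine if_neg ?_
  rintro ⟨hm, h3, h4⟩
  have h5 : (m : ℝ) < n + 1 := by linarith [key n hn]
  have h6 : (n : ℝ) < m + 1 := by linarith [key m hm]
  norm_cast at h5 h6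
  omega

/-- For `G` exponential, the tail integrand is at most one where `h` is nonzero and finite. -/
theorem tailIntegrand_le_indicator {G : Measure ℝ}
    (hG : ∀ u : ℝ, 0 < u → G (Set.Ioi u) = ENNReal.ofReal (Real.exp (-u)))
    {h : ℝ → ℝ≥0∞} {x : ℝ} {s : Set ℝ} (hs : h x ≠ 0 → x ∈ s) (hx : h x ≠ ⊤) {u : ℝ}
    (hu : 0 < u) : tailIntegrand G h u x ≤ s.indicator 1 x := by
  by_cases h0 : h x = 0
  · simp [tailIntegrand, h0]
  have hpos : 0 < u / (h x).toReal := div_pos hu (ENNReal.toReal_pos h0 hx)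
  rw [tailIntegrand, if_neg h0, if_neg hx, hG _ hpos, Set.indicator_of_mem (hs h0)]
  simpa using hpos.le

theorem ofReal_exp_neg_div_le_tailIntegrand {G : Measure ℝ}
    (hG : ∀ u : ℝ, 0 < u → G (Set.Ioi u) = ENNReal.ofReal (Real.exp (-u)))
    {h : ℝ → ℝ≥0∞} {x u c : ℝ} (hu : 0 < u) (hc : 0 < c) (hx : ENNReal.ofReal c ≤ h x) :
    ENNReal.ofReal (Real.exp (-(u / c))) ≤ tailIntegrand G h u x := by
  have h0 : h x ≠ 0 := ((ENNReal.ofReal_pos.2 hc).trans_le hx).ne'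
  rw [← hG _ (div_pos hu hc), tailIntegrand, if_neg h0]
  split_ifs with htop
  · exact measure_mono (Set.Ioi_subset_Ioi (div_pos hu hc).le)
  · refine measure_mono (Set.Ioi_subset_Ioi ?_)
    exact div_le_div_of_nonneg_left hu.le hc ((ENNReal.ofReal_le_iff_le_toReal htop).1 hx)

/-- The unit-ball supremum of the shape function sees the annulus just above `⌊x⌋`. -/
theorem ofReal_div_log_le_supBall_exShape {g : ℝ → ℝ} (hgmono : MonotoneOn g (Set.Ici 0))
    {x u : ℝ} (hx : 1 ≤ x) (hu : 0 < u) (hgx : u ≤ g ⌊x⌋₊) :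
    ENNReal.ofReal (u / (1 + Real.log (2 + x))) ≤
      supBall (fun y => ENNReal.ofReal (exShape g y)) 1 x := by
  set n := ⌊x⌋₊ with hn
  have hn1 : 1 ≤ n := Nat.one_le_floor_iff x |>.2 hx
  have hnx : (n : ℝ) ≤ x := Nat.floor_le (by linarith)
  have hxn : x < n + 1 := Nat.lt_floor_add_one x
  have hn1' : (1 : ℝ) ≤ n := by exact_mod_cast hn1
  have hd : 0 < ((n : ℝ) ^ 2)⁻¹ := by positivity
  have hd1 : ((n : ℝ) ^ 2)⁻¹ ≤ 1 := inv_le_one_of_one_le₀ (one_le_pow₀ hn1')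
  set y : ℝ := n + ((n : ℝ) ^ 2)⁻¹ / 2 with hy
  have hz : y - x ∈ Metric.closedBall (0 : ℝ) 1 := by
    rw [mem_closedBall_zero_iff, Real.norm_eq_abs, abs_le]
    constructor <;> linarith
  refine le_trans ?_ (le_iSup₂ (f := fun z _ => ENNReal.ofReal (exShape g (x + z))) (y - x) hz)
  rw [add_sub_cancel, exShape_eq_of_mem hn1 (by linarith : (n : ℝ) < y) (by linarith)]
  have hgy : g n ≤ g y := hgmono (Set.mem_Ici.2 n.cast_nonneg) (Set.mem_Ici.2 (by linarith)) (by linarith)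
  have hlog : Real.log (1 + y) ≤ Real.log (2 + x) := Real.log_le_log (by linarith) (by linarith)
  have hlog0 : 0 ≤ Real.log (1 + y) := Real.log_nonneg (by linarith)
  apply ENNReal.ofReal_le_ofReal
  gcongr
  · linarith
  · linarith

theorem lintegral_Ioi_const_mul_inv_eq_top {c : ℝ} (hc : 0 < c) {a : ℝ} (ha : 0 ≤ a) :
    ∫⁻ x in Set.Ioi a, ENNReal.ofReal (c * x⁻¹) = ⊤ := by
  by_contra hne
  refine not_integrableOn_Ioi_inv (a := a) ?_
  have hint : IntegrableOn (fun x : ℝ => c * x⁻¹) (Set.Ioi a) := by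
    refine ⟨(measurable_const.mul measurable_inv).aestronglyMeasurable, ?_⟩
    rw [hasFiniteIntegral_iff_ofReal]
    · exact lt_top_iff_ne_top.2 hne
    · filter_upwards [ae_restrict_mem measurableSet_Ioi] with x hx
      have : 0 < x := ha.trans_lt hx
      positivity
  simpa [IntegrableOn, hc.ne'] using hint.const_mul c⁻¹

/-- Example 2.5: for `Ḡ(u) = e^{-u}` and
`h(x) = Σ_{n≥1} (γ(|x|)/(1+ln(1+|x|)))·1_{n < |x| < n+n⁻²}` with `γ` nondecreasing,
`γ(u) → ∞` and `γ(u)/ln u → 0`, one has `α(h,G) = 0` and `α⁺(h,G) = ∞`. -/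
theorem alpha_zero_alphaPlus_top_example
    (G : Measure ℝ)
    (hG : ∀ u : ℝ, 0 < u → G (Set.Ioi u) = ENNReal.ofReal (Real.exp (-u)))
    (g : ℝ → ℝ) (hg0 : ∀ u, 0 ≤ u → 0 ≤ g u) (hgmono : MonotoneOn g (Set.Ici 0))
    (hgtop : Tendsto g atTop atTop)
    (hglog : Tendsto (fun u => g u / Real.log u) atTop (nhds 0)) :
    alphaCoef G (fun x => ENNReal.ofReal (exShape g x)) = 0 ∧
    alphaPlus G (fun x => ENNReal.ofReal (exShape g x)) = ⊤ := by
  constructor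
  · refine le_antisymm (ENNReal.le_of_forall_pos_le_add fun ε hε _ => ?_) zero_le
    rw [zero_add]
    refine sInf_le ⟨ε, ⟨hε, ?_⟩, ENNReal.ofReal_coe_nnreal⟩
    calc ∫⁻ x, tailIntegrand G (fun x => ENNReal.ofReal (exShape g x)) ε x
        ≤ ∫⁻ x, (⋃ n, annulus n).indicator 1 x :=
          lintegral_mono fun x => tailIntegrand_le_indicator (h := fun x => ENNReal.ofReal (exShape g x)) hG
            (fun h => mem_iUnion_annulus_of_exShape_ne_zero (g := g) fun h0 => h (by simp [h0]))
            ENNReal.ofReal_ne_top hε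
      _ = volume (⋃ n, annulus n) :=
          lintegral_indicator_one (MeasurableSet.iUnion measurableSet_annulus)
      _ < ⊤ := volume_iUnion_annulus_lt_top
  · rw [alphaPlus, alphaCoef]
    refine sInf_eq_top.2 ?_
    rintro _ ⟨u, ⟨hu, hfin⟩, rfl⟩
    exfalso
    refine hfin.ne (top_unique ?_)
    obtain ⟨N, hN⟩ := Filter.eventually_atTop.1
      ((hgtop.comp tendsto_natCast_atTop_atTop).eventually_ge_atTop u)
    rw [← lintegral_Ioi_const_mul_inv_eq_top (c := Real.exp (-1) / 3) (by positivity)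
      (show (0 : ℝ) ≤ (N : ℝ) + 1 by positivity)]
    refine (lintegral_mono_ae ?_).trans (setLIntegral_le_lintegral _ _)
    filter_upwards [ae_restrict_mem measurableSet_Ioi] with x hx
    have hxN : (N : ℝ) + 1 < x := hx
    have hN0 : (0 : ℝ) ≤ N := N.cast_nonneg
    have hx1 : 1 ≤ x := by linarith
    have hlog : 0 ≤ Real.log (2 + x) := Real.log_nonneg (by linarith)
    refine le_trans (ENNReal.ofReal_le_ofReal ?_) (ofReal_exp_neg_div_le_tailIntegrand hG hu
      (by positivity) (ofReal_div_log_le_supBall_exShape hgmono hx1 hu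
        (hN _ (Nat.le_floor (by linarith)))))
    rw [div_div_cancel₀ hu.ne', neg_add, Real.exp_add, Real.exp_neg (Real.log _),
      Real.exp_log (by linarith), div_mul_eq_mul_div, mul_div_assoc]
    refine mul_le_mul_of_nonneg_left ?_ (Real.exp_pos _).le
    rw [inv_eq_one_div, inv_eq_one_div, div_div]
    exact one_div_le_one_div_of_le (by linarith) (by linarith)
end
end
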